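/- Let 1/4 ≤ p ≤ 2 and let ξ_1, ξ_2, … be independent random vectors uniform on the unit Euclidean sphere S^3 in ℝ^4. Define φ_p(x) = (1+x)^{-p/2} for x ≥ 0, and Φ_p(x) = φ_p(x) for x ≥ 1 and Φ_p(x) = 2φ_p(1) - φ_p(2-x) for 0 ≤ x ≤ 1. Then for every n ≥ 2 and all nonnegative numbers a_2, …, a_n, E|ξ_1 + Σ_{k=2}^n a_k ξ_k|^{-p} ≤ 2^{p/2} Γ(2 - p/2) · Φ_p( Σ_{k=2}^n a_k² ). -/

import Mathlib

open MeasureTheory Real Set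
open scoped ENNReal

/-- `μ` is the uniform probability measure on the unit sphere `S^{d-1}` in `ℝ^d`:
it is supported on the unit sphere and invariant under every orthogonal map. -/
def IsUniformOnSphere {d : ℕ} (μ : Measure (EuclideanSpace ℝ (Fin d))) : Prop :=
  μ (Metric.sphere (0 : EuclideanSpace ℝ (Fin d)) 1)ᶜ = 0 ∧
  ∀ Q : EuclideanSpace ℝ (Fin d) ≃ₗᵢ[ℝ] EuclideanSpace ℝ (Fin d), μ.map ⇑Q = μ

/-- `Φ_p(x) = φ_p(x) = (1+x)^{-p/2}` for `x ≥ 1`, and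
`Φ_p(x) = 2 φ_p(1) - φ_p(2-x) = 2·2^{-p/2} - (3-x)^{-p/2}` for `0 ≤ x ≤ 1`. -/
noncomputable def Phi (p x : ℝ) : ℝ :=
  if 1 ≤ x then (1 + x) ^ (-p / 2)
  else 2 * (2 : ℝ) ^ (-p / 2) - (3 - x) ^ (-p / 2)

/-- `j` solves the Bessel-type equation `j'' + 3 j' / t + j = 0` on `(0, ∞)` with `j 0 = 1`,
i.e. `j t = 2 J₁(t) / t`; the function `d` is its derivative. -/
structure IsBesselProfile (j d : ℝ → ℝ) : Prop where
  hasDerivAt : ∀ t, HasDerivAt j (d t) t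
  hasDerivAt_deriv : ∀ t, 0 < t → HasDerivAt d (-j t - 3 * d t / t) t
  continuous_deriv : Continuous d
  map_zero : j 0 = 1
  le_one : ∀ t, j t ≤ 1

/-- Coefficients of the power series of `2 J₁(t) / t`. -/
noncomputable def besselCoeff (k : ℕ) : ℝ :=
  (-1) ^ k / (4 ^ k * (k.factorial * (k + 1).factorial))

/-- Partial sums of the power series of `2 J₁(t) / t`. -/
noncomputable def besselPoly (n : ℕ) (t : ℝ) : ℝ :=
  ∑ k ∈ Finset.range (n + 1), besselCoeff k * t ^ (2 * k)

/-- `t` times the derivative of `besselPoly n`. -/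
noncomputable def besselPolyDeriv (n : ℕ) (t : ℝ) : ℝ :=
  ∑ k ∈ Finset.range (n + 1), besselCoeff k * (2 * k) * t ^ (2 * k)

lemma besselCoeff_succ (k : ℕ) :
    besselCoeff (k + 1) * (2 * (k + 1)) * (2 * (k + 2)) = - besselCoeff k := by
  unfold besselCoeff
  have h1 : ((k.factorial : ℝ)) ≠ 0 := by positivity
  have h2 : ((k + 1).factorial : ℝ) = (k + 1) * k.factorial := by
    rw [Nat.factorial_succ]; push_cast; ring
  have h3 : ((k + 1 + 1).factorial : ℝ) = (k + 2) * ((k + 1) * k.factorial) := by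
    rw [Nat.factorial_succ, Nat.factorial_succ]; push_cast; ring
  rw [h2, h3]
  have h4 : (k : ℝ) + 1 ≠ 0 := by positivity
  have h5 : (k : ℝ) + 2 ≠ 0 := by positivity
  field_simp
  ring

lemma hasDerivAt_besselPoly (n : ℕ) {t : ℝ} (ht : 0 < t) :
    HasDerivAt (besselPoly n) (besselPolyDeriv n t / t) t := by
  unfold besselPoly besselPolyDeriv
  rw [Finset.sum_div]
  refine HasDerivAt.fun_sum fun k _ => ?_
  have h := ((hasDerivAt_id t).pow (2 * k)).const_mul (besselCoeff k)
  refine h.congr_deriv ?_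
  rcases k with _ | k
  · simp
  · have : 2 * (k + 1) - 1 = 2 * k + 1 := by omega
    simp only [id, this, mul_one]
    push_cast
    field_simp
    ring

lemma hasDerivAt_sq_mul_besselPolyDeriv (n : ℕ) (t : ℝ) :
    HasDerivAt (fun t => t ^ 2 * besselPolyDeriv (n + 1) t) (-(t ^ 3 * besselPoly n t)) t := by
  have h0 : (fun t => t ^ 2 * besselPolyDeriv (n + 1) t) = fun t : ℝ =>
      ∑ k ∈ Finset.range (n + 1), besselCoeff (k + 1) * (2 * (k + 1)) * t ^ (2 * k + 4) := by
    funext t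
    unfold besselPolyDeriv
    rw [Finset.sum_range_succ', mul_add, Finset.mul_sum]
    simp only [Nat.cast_zero, mul_zero, zero_mul, add_zero]
    refine Finset.sum_congr rfl fun k _ => ?_
    push_cast
    ring
  rw [h0]
  unfold besselPoly
  rw [Finset.mul_sum, ← Finset.sum_neg_distrib]
  refine HasDerivAt.fun_sum fun k _ => ?_
  have h := ((hasDerivAt_id t).pow (2 * k + 4)).const_mul (besselCoeff (k + 1) * (2 * (k + 1)))
  refine h.congr_deriv ?_
  have : 2 * k + 4 - 1 = 2 * k + 3 := by omega
  have h1 := besselCoeff_succ k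
  simp only [id, this, mul_one]
  push_cast
  linear_combination t ^ (2 * k + 3) * h1


namespace IsBesselProfile

variable {j d : ℝ → ℝ}

lemma continuous (h : IsBesselProfile j d) : Continuous j :=
  continuous_iff_continuousAt.2 fun t => (h.hasDerivAt t).continuousAt

lemma hasDerivAt_cube_mul (h : IsBesselProfile j d) {t : ℝ} (ht : 0 < t) :
    HasDerivAt (fun t => t ^ 3 * d t) (-(t ^ 3 * j t)) t := by
  have h1 := ((hasDerivAt_id t).pow 3).mul (h.hasDerivAt_deriv t ht)
  refine h1.congr_deriv ?_
  simp only [Pi.pow_apply, id]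
  push_cast
  field_simp
  ring

end IsBesselProfile

lemma le_of_hasDerivAt_nonneg {f f' : ℝ → ℝ} {a b : ℝ} (hab : a ≤ b)
    (hc : ContinuousOn f (Icc a b)) (hd : ∀ t ∈ Ioo a b, HasDerivAt f (f' t) t)
    (hn : ∀ t ∈ Ioo a b, 0 ≤ f' t) : f a ≤ f b := by
  refine monotoneOn_of_hasDerivWithinAt_nonneg (convex_Icc a b) hc (f' := f') ?_ ?_
    (left_mem_Icc.2 hab) (right_mem_Icc.2 hab) hab
  · rw [interior_Icc]; exact fun t ht => (hd t ht).hasDerivWithinAt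
  · rw [interior_Icc]; exact hn

lemma besselPoly_at_zero (n : ℕ) : besselPoly n 0 = 1 := by
  unfold besselPoly
  rw [Finset.sum_range_succ', Finset.sum_eq_zero]
  · simp [besselCoeff]
  · intro k _; simp

lemma continuous_besselPoly (n : ℕ) : Continuous (besselPoly n) := by
  unfold besselPoly; fun_prop

namespace IsBesselProfile

variable {j d : ℝ → ℝ}

lemma besselPoly_succ_bounds (h : IsBesselProfile j d) (n : ℕ)
    (ih : ∀ t, 0 ≤ t → 0 ≤ (-1) ^ n * (besselPoly n t - j t)) :
    (∀ t, 0 ≤ t → 0 ≤ (-1) ^ (n + 1) * (besselPoly (n + 1) t - j t)) ∧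
    ∀ t, 0 < t → 0 ≤ (-1) ^ (n + 1) * (besselPolyDeriv (n + 1) t - t * d t) := by
  have key : ∀ t, 0 < t → 0 ≤ (-1) ^ (n + 1) * (besselPolyDeriv (n + 1) t - t * d t) := by
    intro t ht
    have := le_of_hasDerivAt_nonneg (a := 0) (b := t) ht.le
      (f := fun t => (-1) ^ (n + 1) * (t ^ 2 * besselPolyDeriv (n + 1) t - t ^ 3 * d t))
      (f' := fun t => (-1) ^ (n + 1) * (-(t ^ 3 * besselPoly n t) - -(t ^ 3 * j t)))
      (by
        have := h.continuous_deriv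
        unfold besselPolyDeriv
        fun_prop)
      (fun s hs => ((hasDerivAt_sq_mul_besselPolyDeriv n s).sub
        (h.hasDerivAt_cube_mul hs.1)).const_mul _)
      (fun s hs => by
        have h1 := mul_nonneg (pow_nonneg hs.1.le 3) (ih s hs.1.le)
        rw [pow_succ]
        linarith)
    have h2 : 0 ≤ t ^ 2 * ((-1) ^ (n + 1) * (besselPolyDeriv (n + 1) t - t * d t)) := by
      simp only [ne_eq, OfNat.ofNat_ne_zero, not_false_eq_true, zero_pow, zero_mul, sub_zero,
        mul_zero] at this
      linarith
    exact nonneg_of_mul_nonneg_right h2 (by positivity)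
  refine ⟨fun t ht => ?_, key⟩
  have := le_of_hasDerivAt_nonneg (a := 0) (b := t) ht
      (f := fun t => (-1) ^ (n + 1) * (besselPoly (n + 1) t - j t))
      (f' := fun t => (-1) ^ (n + 1) * (besselPolyDeriv (n + 1) t / t - d t))
      (by
        have := h.continuous
        have := continuous_besselPoly (n + 1)
        fun_prop)
      (fun s hs => ((hasDerivAt_besselPoly (n + 1) hs.1).sub (h.hasDerivAt s)).const_mul _)
      (fun s hs => by
        have h1 := key s hs.1
        have h2 : besselPolyDeriv (n + 1) s / s - d s =
          (besselPolyDeriv (n + 1) s - s * d s) / s := by field_simp [hs.1.ne']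
        rw [h2, ← mul_div_assoc]
        exact div_nonneg h1 hs.1.le)
  simpa [besselPoly_at_zero, h.map_zero] using this

lemma besselPoly_bounds (h : IsBesselProfile j d) (n : ℕ) : ∀ t, 0 ≤ t →
    0 ≤ (-1) ^ n * (besselPoly n t - j t) := by
  induction n with
  | zero => intro t _; simp [besselPoly, besselCoeff, h.le_one t]
  | succ n ih => exact (h.besselPoly_succ_bounds n ih).1

end IsBesselProfile

/-- The energy `J₀² + J₁²` expressed through `j = 2 J₁ / t`. -/
noncomputable def besselEnergy (j d : ℝ → ℝ) (t : ℝ) : ℝ :=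
  (j t + t * d t / 2) ^ 2 + (t * j t / 2) ^ 2

/-- A corrected energy, increasing in `t`. -/
noncomputable def besselEnergyTwo (j d : ℝ → ℝ) (t : ℝ) : ℝ :=
  t * besselEnergy j d t - (j t + t * d t / 2) * (t * j t) / 2 - t * j t ^ 2 / 8

namespace IsBesselProfile

variable {j d : ℝ → ℝ}

lemma hasDerivAt_energy (h : IsBesselProfile j d) {t : ℝ} (ht : 0 < t) :
    HasDerivAt (besselEnergy j d) (-(t * j t ^ 2 / 2)) t := by
  have hj := h.hasDerivAt t
  have hd := h.hasDerivAt_deriv t ht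
  have hi := hasDerivAt_id t
  have h1 := ((hj.add ((hi.mul hd).div_const 2)).pow 2).add (((hi.mul hj).div_const 2).pow 2)
  refine h1.congr_deriv ?_
  simp only [Pi.add_apply, Pi.mul_apply, id]
  field_simp
  ring

lemma continuous_energy (h : IsBesselProfile j d) : Continuous (besselEnergy j d) := by
  have := h.continuous
  have := h.continuous_deriv
  unfold besselEnergy
  fun_prop

lemma hasDerivAt_energyTwo (h : IsBesselProfile j d) {t : ℝ} (ht : 0 < t) :
    HasDerivAt (besselEnergyTwo j d) (3 * j t ^ 2 / 8) t := by
  have hj := h.hasDerivAt t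
  have hd := h.hasDerivAt_deriv t ht
  have hi := hasDerivAt_id t
  have h1 := ((hi.mul (h.hasDerivAt_energy ht)).sub
    (((hj.add ((hi.mul hd).div_const 2)).mul (hi.mul hj)).div_const 2)).sub
    ((hi.mul (hj.pow 2)).div_const 8)
  refine h1.congr_deriv ?_
  simp only [Pi.add_apply, Pi.mul_apply, Pi.pow_apply, id]
  unfold besselEnergy
  field_simp
  ring

lemma energy_zero (h : IsBesselProfile j d) : besselEnergy j d 0 = 1 := by
  simp [besselEnergy, h.map_zero]

lemma le_energyTwo {t : ℝ} (ht : 0 ≤ t) :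
    t * j t ^ 2 * (4 * t ^ 2 - 3) / 16 ≤ besselEnergyTwo j d t := by
  have h1 : besselEnergyTwo j d t - t * j t ^ 2 * (4 * t ^ 2 - 3) / 16 =
      t * ((j t + t * d t / 2) - j t / 4) ^ 2 := by
    unfold besselEnergyTwo besselEnergy; ring
  have : 0 ≤ t * ((j t + t * d t / 2) - j t / 4) ^ 2 := by positivity
  linarith

lemma energyTwo_le {t : ℝ} (ht : 0 ≤ t) :
    besselEnergyTwo j d t ≤ (t + 1 / 2) * besselEnergy j d t := by
  unfold besselEnergyTwo besselEnergy
  nlinarith [sq_nonneg (j t + t * d t / 2 + t * j t / 2), mul_nonneg ht (sq_nonneg (j t))]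

lemma energyTwo_monotone (h : IsBesselProfile j d) {a b : ℝ} (ha : 0 < a) (hab : a ≤ b) :
    besselEnergyTwo j d a ≤ besselEnergyTwo j d b := by
  refine le_of_hasDerivAt_nonneg hab ?_
    (fun t ht => h.hasDerivAt_energyTwo (ha.trans ht.1)) (fun t _ => by positivity)
  exact fun t ht => (h.hasDerivAt_energyTwo (ha.trans_le ht.1)).continuousAt.continuousWithinAt

lemma energyTwo_div_antitone (h : IsBesselProfile j d) {a b : ℝ} (ha : 1 ≤ a) (hab : a ≤ b) :
    besselEnergyTwo j d b * (4 * b ^ 2) / (4 * b ^ 2 - 3) ≤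
      besselEnergyTwo j d a * (4 * a ^ 2) / (4 * a ^ 2 - 3) := by
  have hder : ∀ t, 1 ≤ t → HasDerivAt
      (fun t => -(besselEnergyTwo j d t * (4 * t ^ 2) / (4 * t ^ 2 - 3)))
      (24 * t * (besselEnergyTwo j d t - t * j t ^ 2 * (4 * t ^ 2 - 3) / 16) /
        (4 * t ^ 2 - 3) ^ 2) t := by
    intro t ht
    have hne : 4 * t ^ 2 - 3 ≠ 0 := by nlinarith
    have h4 : HasDerivAt (fun t : ℝ => 4 * t ^ 2) (4 * (2 * t)) t := by
      simpa using (hasDerivAt_pow 2 t).const_mul 4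
    have h1 := (((h.hasDerivAt_energyTwo (by linarith : (0:ℝ) < t)).mul h4).div
      (h4.sub_const 3) hne).neg
    refine h1.congr_deriv ?_
    simp only [Pi.mul_apply]
    field_simp
    ring
  have := le_of_hasDerivAt_nonneg hab
    (fun t ht => (hder t (ha.trans ht.1)).continuousAt.continuousWithinAt)
    (fun t ht => hder t (ha.trans ht.1.le)) (fun t ht => by
      have h0 : 0 < t := by linarith [ht.1]
      have := le_energyTwo (j := j) (d := d) h0.le
      have h1 := mul_nonneg (by linarith : 0 ≤ 24 * t) (sub_nonneg.2 this)
      positivity)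
  linarith

lemma upper_poly (h : IsBesselProfile j d) {n : ℕ} (hn : Even n) {t : ℝ} (ht : 0 ≤ t) :
    j t ≤ besselPoly n t := by
  have := h.besselPoly_bounds n t ht
  rw [hn.neg_one_pow] at this
  linarith

lemma lower_poly (h : IsBesselProfile j d) {n : ℕ} (hn : Odd n) {t : ℝ} (ht : 0 ≤ t) :
    besselPoly n t ≤ j t := by
  have := h.besselPoly_bounds n t ht
  rw [hn.neg_one_pow] at this
  linarith

lemma deriv_upper_poly (h : IsBesselProfile j d) {n : ℕ} (hn : Odd n) {t : ℝ} (ht : 0 < t) :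
    t * d t ≤ besselPolyDeriv (n + 1) t := by
  have := (h.besselPoly_succ_bounds n (h.besselPoly_bounds n)).2 t ht
  rw [hn.add_one.neg_one_pow] at this
  linarith

lemma deriv_lower_poly (h : IsBesselProfile j d) {n : ℕ} (hn : Even n) {t : ℝ} (ht : 0 < t) :
    besselPolyDeriv (n + 1) t ≤ t * d t := by
  have := (h.besselPoly_succ_bounds n (h.besselPoly_bounds n)).2 t ht
  rw [hn.add_one.neg_one_pow] at this
  linarith

lemma map_seven_halves_bounds (h : IsBesselProfile j d) :
    0.0784 ≤ j (7 / 2) ∧ j (7 / 2) ≤ 0.0786 := by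
  constructor
  · refine le_trans ?_ (h.lower_poly (n := 7) (by decide) (by norm_num))
    norm_num [besselPoly, Finset.sum_range_succ, besselCoeff, Nat.factorial]
  · refine le_trans (h.upper_poly (n := 8) (by decide) (by norm_num)) ?_
    norm_num [besselPoly, Finset.sum_range_succ, besselCoeff, Nat.factorial]

lemma deriv_seven_halves_bounds (h : IsBesselProfile j d) :
    -0.9176 ≤ 7 / 2 * d (7 / 2) ∧ 7 / 2 * d (7 / 2) ≤ -0.917 := by
  constructor
  · refine le_trans ?_ (h.deriv_lower_poly (n := 6) (by decide) (by norm_num))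
    norm_num [besselPolyDeriv, Finset.sum_range_succ, besselCoeff, Nat.factorial]
  · refine le_trans (h.deriv_upper_poly (n := 7) (by decide) (by norm_num)) ?_
    norm_num [besselPolyDeriv, Finset.sum_range_succ, besselCoeff, Nat.factorial]

lemma energyTwo_seven_halves_bounds (h : IsBesselProfile j d) :
    0.615 ≤ besselEnergyTwo j d (7 / 2) ∧ besselEnergyTwo j d (7 / 2) ≤ 0.63 := by
  obtain ⟨h1, h2⟩ := h.map_seven_halves_bounds
  obtain ⟨h3, h4⟩ := h.deriv_seven_halves_bounds
  unfold besselEnergyTwo besselEnergy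
  set x := j (7 / 2)
  set y := 7 / 2 * d (7 / 2)
  constructor <;> nlinarith [mul_nonneg (sub_nonneg.2 h1) (sub_nonneg.2 h2),
    mul_nonneg (sub_nonneg.2 h3) (sub_nonneg.2 h4), mul_nonneg (sub_nonneg.2 h1) (sub_nonneg.2 h3),
    mul_nonneg (sub_nonneg.2 h1) (sub_nonneg.2 h4), mul_nonneg (sub_nonneg.2 h2) (sub_nonneg.2 h3),
    mul_nonneg (sub_nonneg.2 h2) (sub_nonneg.2 h4)]

lemma sq_le_of_seven_halves_le (h : IsBesselProfile j d) {t : ℝ} (ht : 7 / 2 ≤ t) :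
    j t ^ 2 ≤ 2.685 / t ^ 3 := by
  have h0 : 0 < t := by linarith
  have h1 := h.energyTwo_div_antitone (by norm_num) ht
  have h2 := h.energyTwo_seven_halves_bounds.2
  have h3 := le_energyTwo (j := j) (d := d) h0.le
  have hp : 0 < 4 * t ^ 2 - 3 := by nlinarith
  have h5 : besselEnergyTwo j d t * (4 * t ^ 2) / (4 * t ^ 2 - 3) ≤ 2.685 / 4 :=
    h1.trans (by norm_num; linarith)
  rw [div_le_iff₀ hp] at h5
  rw [le_div_iff₀ (by positivity)]
  have h6 : t * j t ^ 2 * (4 * t ^ 2 - 3) / 16 * (4 * t ^ 2) ≤ 2.685 / 4 * (4 * t ^ 2 - 3) :=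
    (mul_le_mul_of_nonneg_right h3 (by positivity)).trans h5
  have h7 : (j t ^ 2 * t ^ 3) * (4 * t ^ 2 - 3) ≤ 2.685 * (4 * t ^ 2 - 3) := by linarith
  exact le_of_mul_le_mul_right h7 hp

lemma le_energy_of_seven_halves_le (h : IsBesselProfile j d) {t : ℝ} (ht : 7 / 2 ≤ t) :
    0.615 / (t + 1 / 2) ≤ besselEnergy j d t := by
  rw [div_le_iff₀ (by linarith)]
  have h1 := h.energyTwo_monotone (by norm_num) ht
  have h2 := h.energyTwo_seven_halves_bounds.1
  have h3 := energyTwo_le (j := j) (d := d) (by linarith : 0 ≤ t)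
  linarith

lemma energy_antitone (h : IsBesselProfile j d) {a b : ℝ} (ha : 0 ≤ a) (hab : a ≤ b) :
    besselEnergy j d b ≤ besselEnergy j d a := by
  have := le_of_hasDerivAt_nonneg hab (f := fun t => -besselEnergy j d t)
    h.continuous_energy.neg.continuousOn
    (fun t ht => (h.hasDerivAt_energy (ha.trans_lt ht.1)).neg)
    (fun t ht => by
      have : 0 < t := ha.trans_lt ht.1
      rw [neg_neg]; positivity)
  linarith

lemma deriv_nonpos (h : IsBesselProfile j d) {t : ℝ} (ht : 0 < t) (ht' : t ≤ 7 / 2) :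
    d t ≤ 0 := by
  have h1 := h.deriv_upper_poly (n := 3) (by decide) ht
  have h2 : besselPolyDeriv (3 + 1) t ≤ 0 := by
    have e : besselPolyDeriv (3 + 1) t =
      t ^ 2 / 4 * (-1 + t ^ 2 / 4 / 3 - (t ^ 2 / 4) ^ 2 / 24 + (t ^ 2 / 4) ^ 3 / 360) := by
      simp only [besselPolyDeriv, Finset.sum_range_succ, besselCoeff, Nat.factorial]
      norm_num
      ring
    rw [e]
    have hz : t ^ 2 / 4 ≤ 49 / 16 := by nlinarith
    have hz0 : 0 < t ^ 2 / 4 := by positivity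
    set z := t ^ 2 / 4
    refine mul_nonpos_of_nonneg_of_nonpos hz0.le ?_
    nlinarith [mul_nonneg hz0.le (sub_nonneg.2 hz),
      mul_nonneg (mul_nonneg hz0.le hz0.le) (sub_nonneg.2 hz)]
  nlinarith

lemma antitone_of_le (h : IsBesselProfile j d) {a b : ℝ} (ha : 0 ≤ a) (hab : a ≤ b)
    (hb : b ≤ 7 / 2) : j b ≤ j a := by
  have := le_of_hasDerivAt_nonneg hab (f := fun t => -j t)
    h.continuous.neg.continuousOn (fun t _ => (h.hasDerivAt t).neg)
    (fun t ht => by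
      have := h.deriv_nonpos (ha.trans_lt ht.1) (ht.2.le.trans hb)
      linarith)
  linarith

lemma nonneg_of_le (h : IsBesselProfile j d) {t : ℝ} (ht : 0 ≤ t) (ht' : t ≤ 7 / 2) :
    0 ≤ j t := by
  have := h.antitone_of_le ht ht' le_rfl
  linarith [h.map_seven_halves_bounds.1]

lemma lower_of_sq_le_eight (h : IsBesselProfile j d) {t : ℝ} (ht : 0 ≤ t) (ht' : t ^ 2 ≤ 8) :
    0.28 ≤ j t := by
  have h8 : √8 ^ 2 = (8 : ℝ) := Real.sq_sqrt (by norm_num)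
  have h0 : 0 ≤ √(8 : ℝ) := Real.sqrt_nonneg _
  have h1 : t ≤ √8 := Real.le_sqrt_of_sq_le ht'
  have h2 : √(8 : ℝ) ≤ 7 / 2 := by nlinarith
  refine le_trans ?_ (h.antitone_of_le ht h1 h2)
  refine le_trans ?_ (h.lower_poly (n := 5) (by decide) h0)
  have : ∀ k : ℕ, √(8 : ℝ) ^ (2 * k) = 8 ^ k := fun k => by rw [pow_mul, h8]
  simp only [besselPoly, this, Finset.sum_range_succ, besselCoeff, Nat.factorial]
  norm_num

lemma le_exp_of_le (h : IsBesselProfile j d) {t : ℝ} (ht : 0 ≤ t) (ht' : t ≤ 7 / 2) :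
    j t ≤ exp (-t ^ 2 / 8) := by
  have hD : ∀ s, 0 ≤ s → s ≤ 7 / 2 → s ^ 3 * d s + s ^ 4 * j s / 4 ≤ 0 := by
    intro s hs hs'
    have := le_of_hasDerivAt_nonneg hs (f := fun s => -(s ^ 3 * d s + s ^ 4 * j s / 4))
      (by
        have := h.continuous
        have := h.continuous_deriv
        fun_prop)
      (fun r hr => ((h.hasDerivAt_cube_mul hr.1).add
        (((hasDerivAt_pow 4 r).mul (h.hasDerivAt r)).div_const 4)).neg)
      (fun r hr => by
        have h1 := h.deriv_nonpos hr.1 (hr.2.le.trans hs')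
        have h2 : 0 ≤ r ^ 4 := by positivity
        push_cast
        nlinarith [mul_nonneg h2 (neg_nonneg.2 h1)])
    simp at this
    linarith
  have := le_of_hasDerivAt_nonneg ht (f := fun s => -(j s * exp (s ^ 2 / 8)))
    (by
      have := h.continuous
      fun_prop)
    (fun r hr => ((h.hasDerivAt r).mul ((hasDerivAt_pow 2 r).div_const 8).exp).neg)
    (fun r hr => by
      have h1 := hD r hr.1.le (hr.2.le.trans ht')
      have h3 : r ^ 3 * (d r + r * j r / 4) ≤ 0 := by linarith
      have h2 : d r + r * j r / 4 ≤ 0 := by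
        by_contra hcon
        push Not at hcon
        have := mul_pos (pow_pos hr.1 3) hcon
        linarith
      have h4 := mul_nonneg (exp_pos (r ^ 2 / 8)).le (neg_nonneg.2 h2)
      push_cast
      simp only [pow_one]
      linarith)
  simp only [h.map_zero] at this
  simp at this
  rw [neg_div, exp_neg, ← one_div, le_div_iff₀ (exp_pos _)]
  linarith

end IsBesselProfile

lemma integral_mul_exp_neg_sq (a b : ℝ) :
    ∫ t in a..b, t * exp (-t ^ 2 / 4) = 2 * exp (-a ^ 2 / 4) - 2 * exp (-b ^ 2 / 4) := by
  have h : ∀ t ∈ uIcc a b,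
      HasDerivAt (fun t => -2 * exp (-t ^ 2 / 4)) (t * exp (-t ^ 2 / 4)) t := by
    intro t _
    refine ((((hasDerivAt_pow 2 t).neg).div_const 4).exp.const_mul (-2)).congr_deriv ?_
    simp only [Pi.neg_apply]
    push_cast
    ring
  rw [intervalIntegral.integral_eq_sub_of_hasDerivAt h
    (Continuous.intervalIntegrable (by fun_prop) _ _)]
  ring

lemma integral_mul_min_exp_le {u τ : ℝ} (hu : 0 < u) (hu1 : u ≤ 1) (hτ : 0 ≤ τ)
    (h : exp (-τ ^ 2 / 4) ≤ u) :
    ∫ t in (0)..τ, t * min (exp (-t ^ 2 / 4)) u ≤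
      -2 * u * log u + 2 * u - 2 * exp (-τ ^ 2 / 4) := by
  set σ := √(-4 * log u) with hσ
  have hlog : log u ≤ 0 := log_nonpos hu.le hu1
  have hσ2 : σ ^ 2 = -4 * log u := Real.sq_sqrt (by linarith)
  have hσ0 : 0 ≤ σ := Real.sqrt_nonneg _
  have hστ : σ ≤ τ := by
    have h1 : -τ ^ 2 / 4 ≤ log u := by rwa [← exp_le_exp, exp_log hu]
    exact Real.sqrt_le_iff.2 ⟨hτ, by linarith⟩
  have hc : Continuous fun t : ℝ => t * min (exp (-t ^ 2 / 4)) u := by fun_prop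
  rw [← intervalIntegral.integral_add_adjacent_intervals (hc.intervalIntegrable 0 σ)
    (hc.intervalIntegrable σ τ)]
  have e1 : ∫ t in (0)..σ, t * min (exp (-t ^ 2 / 4)) u ≤ ∫ t in (0)..σ, t * u :=
    intervalIntegral.integral_mono_on hσ0 (hc.intervalIntegrable _ _)
      (Continuous.intervalIntegrable (by fun_prop) _ _)
      fun t ht => mul_le_mul_of_nonneg_left (min_le_right _ _) ht.1
  have e2 : ∫ t in σ..τ, t * min (exp (-t ^ 2 / 4)) u ≤ ∫ t in σ..τ, t * exp (-t ^ 2 / 4) :=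
    intervalIntegral.integral_mono_on hστ (hc.intervalIntegrable _ _)
      (Continuous.intervalIntegrable (by fun_prop) _ _)
      fun t ht => mul_le_mul_of_nonneg_left (min_le_left _ _) (hσ0.trans ht.1)
  have e3 : exp (-σ ^ 2 / 4) = u := by
    rw [hσ2, show -(-4 * log u) / 4 = log u by ring, exp_log hu]
  rw [integral_mul_exp_neg_sq, e3] at e2
  rw [intervalIntegral.integral_mul_const, integral_id, hσ2] at e1
  linarith

lemma exp_neg_mul_le {τ : ℝ} (hτ : 7 / 2 ≤ τ) :
    2 * exp (-τ ^ 2 / 4) * (τ ^ 2 / 4 - 1) ≤ 2 * (0.615 / (τ + 1 / 2)) := by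
  set y := τ ^ 2 / 4 with hy
  have hy0 : 49 / 16 ≤ y := by nlinarith
  have e1 : -τ ^ 2 / 4 = -y := by rw [hy]; ring
  have h1 : τ + 1 / 2 ≤ 4 * y / 7 + 9 / 4 := by nlinarith [sq_nonneg (τ - 7 / 2)]
  have h2 := Real.sum_le_exp_of_nonneg (by linarith : 0 ≤ y) 5
  simp only [Finset.sum_range_succ, Finset.sum_range_zero, Nat.factorial] at h2
  norm_num at h2
  rw [e1, exp_neg, mul_assoc]
  refine mul_le_mul_of_nonneg_left ?_ (by norm_num)
  rw [inv_mul_eq_div, div_le_div_iff₀ (exp_pos _) (by linarith)]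
  have h3 : (y - 1) * (τ + 1 / 2) ≤ (y - 1) * (4 * y / 7 + 9 / 4) :=
    mul_le_mul_of_nonneg_left h1 (by linarith)
  refine h3.trans (le_trans ?_ (mul_le_mul_of_nonneg_left h2 (by norm_num)))
  obtain ⟨s, hs, hys⟩ : ∃ s, 0 ≤ s ∧ y = s + 49 / 16 := ⟨y - 49 / 16, by linarith, by ring⟩
  rw [hys]
  norm_num
  ring_nf
  nlinarith [pow_nonneg hs 2, pow_nonneg hs 3, pow_nonneg hs 4]

lemma log_term_le {u x : ℝ} (hx : 7 / 2 ≤ x) (hu : u = 2.685 / x ^ 3) :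
    -2 * u * log u - 2 * u ≤ 2 * (0.615 / (x + 1 / 2)) := by
  have h0 : 0 < x := by linarith
  have h1 : -log u ≤ 3 * (x / (7 / 2) - 1) + 2.7728 := by
    have e : u⁻¹ = (x / (7 / 2)) ^ 3 * (42.875 / 2.685) := by
      rw [hu]; field_simp; norm_num
    rw [← log_inv, e, log_mul (by positivity) (by norm_num), log_pow]
    have h2 := log_le_sub_one_of_pos (by positivity : 0 < x / (7 / 2))
    have h3 : log (42.875 / 2.685) ≤ log (2 ^ 4) := log_le_log (by norm_num) (by norm_num)
    rw [log_pow] at h3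
    have := Real.log_two_lt_d9
    push_cast at *
    linarith
  have hu0 : 0 < u := by rw [hu]; positivity
  have h2 : -2 * u * log u - 2 * u ≤ 2 * (u * (3 * (x / (7 / 2) - 1) + 2.7728 - 1)) := by
    nlinarith
  refine h2.trans (mul_le_mul_of_nonneg_left ?_ (by norm_num))
  rw [hu, div_mul_eq_mul_div, div_le_div_iff₀ (by positivity) (by linarith)]
  obtain ⟨s, hs, rfl⟩ : ∃ s, 0 ≤ s ∧ x = s + 7 / 2 := ⟨x - 7 / 2, by linarith, by ring⟩
  norm_num
  ring_nf
  nlinarith [pow_nonneg hs 2, pow_nonneg hs 3]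

namespace IsBesselProfile

variable {j d : ℝ → ℝ}

lemma integral_mul_sq (h : IsBesselProfile j d) {a b : ℝ} (ha : 0 ≤ a) (hab : a ≤ b) :
    ∫ t in a..b, t * j t ^ 2 = 2 * besselEnergy j d a - 2 * besselEnergy j d b := by
  have hj := h.continuous
  rw [intervalIntegral.integral_eq_sub_of_hasDerivAt_of_le hab
    (f := fun t => -2 * besselEnergy j d t) (h.continuous_energy.const_mul _).continuousOn
    (fun t ht => ((h.hasDerivAt_energy (ha.trans_lt ht.1)).const_mul (-2)).congr_deriv (by ring))
    (Continuous.intervalIntegrable (by fun_prop) _ _)]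
  ring

lemma four_mul_le_integral (h : IsBesselProfile j d) {u τ : ℝ} (hu0 : 0 ≤ u) (hu : u ≤ 0.07)
    (hτ : 7 / 2 ≤ τ) : 4 * u ≤ ∫ t in (0)..τ, t * min (j t ^ 2) u := by
  have hj := h.continuous
  have hc : Continuous fun t : ℝ => t * min (j t ^ 2) u := by fun_prop
  have h8 : √8 ^ 2 = (8 : ℝ) := Real.sq_sqrt (by norm_num)
  have h0 : 0 ≤ √(8 : ℝ) := Real.sqrt_nonneg _
  have h2 : √(8 : ℝ) ≤ τ := by nlinarith
  rw [← intervalIntegral.integral_add_adjacent_intervals (hc.intervalIntegrable 0 √8)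
    (hc.intervalIntegrable √8 τ)]
  have e1 : ∫ t in (0)..√8, t * min (j t ^ 2) u = ∫ t in (0)..√8, t * u := by
    refine intervalIntegral.integral_congr fun t ht => ?_
    rw [uIcc_of_le h0] at ht
    have := h.lower_of_sq_le_eight ht.1 (by nlinarith [ht.1, ht.2])
    rw [min_eq_right]
    nlinarith
  have e2 : 0 ≤ ∫ t in √8..τ, t * min (j t ^ 2) u :=
    intervalIntegral.integral_nonneg h2 fun t ht =>
      mul_nonneg (h0.trans ht.1) (le_min (sq_nonneg _) hu0)
  rw [e1, intervalIntegral.integral_mul_const, integral_id, h8]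
  linarith

lemma energy_add_integral_le (h : IsBesselProfile j d) {u τ x : ℝ} (hx : 7 / 2 ≤ x)
    (hu : u = 2.685 / x ^ 3) (hτ : 7 / 2 ≤ τ) :
    2 * besselEnergy j d x + 4 * u ≤
      2 * besselEnergy j d τ + ∫ t in (0)..τ, t * min (j t ^ 2) u := by
  have hu0 : 0 ≤ u := by rw [hu]; positivity
  have hu1 : u ≤ 0.07 := by
    rw [hu, div_le_iff₀ (by positivity)]
    have : (7 / 2 : ℝ) ^ 3 ≤ x ^ 3 := pow_le_pow_left₀ (by norm_num) hx 3
    linarith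
  rcases le_total τ x with hτx | hτx
  · have h1 := h.energy_antitone (by linarith) hτx
    have h2 := h.four_mul_le_integral hu0 hu1 hτ
    linarith
  · have hj := h.continuous
    have hc : Continuous fun t : ℝ => t * min (j t ^ 2) u := by fun_prop
    rw [← intervalIntegral.integral_add_adjacent_intervals (hc.intervalIntegrable 0 x)
      (hc.intervalIntegrable x τ)]
    have h2 := h.four_mul_le_integral hu0 hu1 hx
    have e1 : ∫ t in x..τ, t * min (j t ^ 2) u = ∫ t in x..τ, t * j t ^ 2 := by
      refine intervalIntegral.integral_congr fun t ht => ?_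
      rw [uIcc_of_le hτx] at ht
      rw [min_eq_left]
      refine (h.sq_le_of_seven_halves_le (hx.trans ht.1)).trans ?_
      have := ht.1
      rw [hu]
      gcongr
    rw [e1, h.integral_mul_sq (by linarith) hτx]
    linarith

lemma integral_max_sub_le (h : IsBesselProfile j d) {u τ : ℝ} (hu : 0 ≤ u) (hτ : 0 ≤ τ) :
    ∫ t in (0)..τ, t * max (j t ^ 2 - u) 0 ≤
      ∫ t in (0)..τ, t * max (exp (-t ^ 2 / 4) - u) 0 := by
  have hj := h.continuous
  have hcj : Continuous fun t : ℝ => t * max (j t ^ 2 - u) 0 := by fun_prop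
  have hce : Continuous fun t : ℝ => t * max (exp (-t ^ 2 / 4) - u) 0 := by fun_prop
  have hsmall : ∀ t, 0 ≤ t → t ≤ 7 / 2 →
      t * max (j t ^ 2 - u) 0 ≤ t * max (exp (-t ^ 2 / 4) - u) 0 := by
    intro t h0 h1
    have h2 := pow_le_pow_left₀ (h.nonneg_of_le h0 h1) (h.le_exp_of_le h0 h1) 2
    rw [← exp_nat_mul] at h2
    have e : ((2 : ℕ) : ℝ) * (-t ^ 2 / 8) = -t ^ 2 / 4 := by push_cast; ring
    rw [e] at h2
    gcongr
  by_cases hcase : τ ≤ 7 / 2 ∨ 2.685 / (7 / 2) ^ 3 ≤ u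
  · refine intervalIntegral.integral_mono_on hτ (hcj.intervalIntegrable _ _)
      (hce.intervalIntegrable _ _) fun t ht => ?_
    rcases le_or_gt t (7 / 2) with h1 | h1
    · exact hsmall t ht.1 h1
    · refine mul_le_mul_of_nonneg_left (max_le ?_ (le_max_right _ _)) ht.1
      refine le_trans ?_ (le_max_right _ _)
      rcases hcase with h2 | h2
      · linarith [ht.2]
      · have h3 := h.sq_le_of_seven_halves_le h1.le
        have h4 : 2.685 / t ^ 3 ≤ 2.685 / (7 / 2) ^ 3 := by gcongr
        linarith
  · push Not at hcase
    obtain ⟨hτ1, hu1⟩ := hcase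
    have hsub : ∀ f : ℝ → ℝ, Continuous f → ∫ t in (0)..τ, t * max (f t - u) 0 =
        (∫ t in (0)..τ, t * f t) - ∫ t in (0)..τ, t * min (f t) u := by
      intro f hf
      rw [← intervalIntegral.integral_sub (Continuous.intervalIntegrable (by fun_prop) _ _)
        (Continuous.intervalIntegrable (by fun_prop) _ _)]
      refine intervalIntegral.integral_congr fun t _ => ?_
      rw [← mul_sub]
      congr 1
      rcases le_total (f t) u with h1 | h1
      · rw [max_eq_right (by linarith), min_eq_left h1, sub_self]
      · rw [max_eq_left (by linarith), min_eq_right h1]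
    rw [hsub (fun t => j t ^ 2) (by fun_prop), hsub (fun t => exp (-t ^ 2 / 4)) (by fun_prop),
      h.integral_mul_sq le_rfl hτ, h.energy_zero, integral_mul_exp_neg_sq]
    have hu2 : u ≤ 0.07 := hu1.le.trans (by norm_num)
    have hsuff : 2 * exp (-τ ^ 2 / 4) + ∫ t in (0)..τ, t * min (exp (-t ^ 2 / 4)) u ≤
        2 * besselEnergy j d τ + ∫ t in (0)..τ, t * min (j t ^ 2) u := by
      rcases le_or_gt u (exp (-τ ^ 2 / 4)) with h1 | h1
      · have e1 : ∫ t in (0)..τ, t * min (exp (-t ^ 2 / 4)) u ≤ ∫ t in (0)..τ, t * u :=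
          intervalIntegral.integral_mono_on hτ (Continuous.intervalIntegrable (by fun_prop) _ _)
            (Continuous.intervalIntegrable (by fun_prop) _ _)
            fun t ht => mul_le_mul_of_nonneg_left (min_le_right _ _) ht.1
        rw [intervalIntegral.integral_mul_const, integral_id] at e1
        have h2 := h.four_mul_le_integral hu hu2 hτ1.le
        have h3 := exp_neg_mul_le hτ1.le
        have h4 := h.le_energy_of_seven_halves_le hτ1.le
        have h5 : 0 ≤ τ ^ 2 / 4 - 2 := by nlinarith
        have h6 := mul_le_mul_of_nonneg_right h1 h5
        linarith
      · have hu0 : 0 < u := (exp_pos _).trans h1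
        have e1 := integral_mul_min_exp_le hu0 (by linarith) hτ h1.le
        set x := (2.685 / u) ^ ((3 : ℕ) : ℝ)⁻¹ with hx
        have hx3 : x ^ 3 = 2.685 / u := Real.rpow_inv_natCast_pow (by positivity) (by norm_num)
        have hx0 : 0 ≤ x := by positivity
        have hx1 : 7 / 2 ≤ x := by
          refine le_of_pow_le_pow_left₀ (n := 3) (by norm_num) hx0 ?_
          rw [hx3, le_div_iff₀ hu0]
          rw [lt_div_iff₀ (by norm_num)] at hu1
          linarith
        have hux : u = 2.685 / x ^ 3 := by rw [hx3]; field_simp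
        have h2 := log_term_le hx1 hux
        have h3 := h.le_energy_of_seven_halves_le hx1
        have h4 := h.energy_add_integral_le hx1 hux hτ1.le
        linarith
    simp only [ne_eq, OfNat.ofNat_ne_zero, not_false_eq_true, zero_pow, neg_zero, zero_div,
      exp_zero, mul_one] at *
    linarith

end IsBesselProfile

lemma lintegral_layer_cake_max {α f : ℝ} (hα : 1 < α) (hf : 0 ≤ f) :
    ∫⁻ y in Ioi (0 : ℝ), ENNReal.ofReal (α * (α - 1) * y ^ (α - 2)) *
        ENNReal.ofReal (max (f - y) 0) =
      ENNReal.ofReal (f ^ α) := by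
  have hsplit : Ioi (0 : ℝ) = Ioc 0 f ∪ Ioi f := (Ioc_union_Ioi_eq_Ioi hf).symm
  have h1 : ∫⁻ y in Ioi f, ENNReal.ofReal (α * (α - 1) * y ^ (α - 2)) *
      ENNReal.ofReal (max (f - y) 0) = 0 := by
    rw [setLIntegral_congr_fun measurableSet_Ioi (g := fun _ => 0)]
    · simp
    · intro y hy
      simp only
      rw [max_eq_right (by linarith [mem_Ioi.1 hy]), ENNReal.ofReal_zero, mul_zero]
  rw [hsplit, lintegral_union measurableSet_Ioi (Ioc_disjoint_Ioi le_rfl), h1, add_zero]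
  have hint1 : IntervalIntegrable (fun y : ℝ => f * y ^ (α - 2)) volume 0 f :=
    (intervalIntegral.intervalIntegrable_rpow' (by linarith)).const_mul f
  have hint2 : IntervalIntegrable (fun y : ℝ => y ^ (α - 1)) volume 0 f :=
    intervalIntegral.intervalIntegrable_rpow' (by linarith)
  have hInt : IntervalIntegrable (fun y : ℝ => α * (α - 1) * (f * y ^ (α - 2) - y ^ (α - 1)))
      volume 0 f := (hint1.sub hint2).const_mul _
  have hpt : ∀ y ∈ Ioc 0 f, ENNReal.ofReal (α * (α - 1) * y ^ (α - 2)) *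
      ENNReal.ofReal (max (f - y) 0) =
      ENNReal.ofReal (α * (α - 1) * (f * y ^ (α - 2) - y ^ (α - 1))) := by
    intro y hy
    have hy0 := hy.1
    have e : y ^ (α - 1) = y ^ (α - 2) * y := by
      rw [← Real.rpow_add_one hy0.ne']; ring_nf
    rw [max_eq_left (by linarith [hy.2]), ← ENNReal.ofReal_mul, e]
    · ring_nf
    · have : 0 < α - 1 := by linarith
      positivity
  rw [setLIntegral_congr_fun measurableSet_Ioc hpt, ← ofReal_integral_eq_lintegral_ofReal,
    ← intervalIntegral.integral_of_le hf]
  · congr 1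
    rw [intervalIntegral.integral_const_mul, intervalIntegral.integral_sub hint1 hint2,
      intervalIntegral.integral_const_mul, integral_rpow (Or.inl (by linarith)),
      integral_rpow (Or.inl (by linarith))]
    have e1 : α - 2 + 1 = α - 1 := by ring
    have e2 : α - 1 + 1 = α := by ring
    have e3 : f * f ^ (α - 1) = f ^ α := by
      rcases hf.eq_or_lt with rfl | hf
      · rw [zero_mul, Real.zero_rpow (by linarith)]
      · rw [mul_comm, ← Real.rpow_add_one hf.ne', e2]
    rw [e1, e2, Real.zero_rpow (by linarith), Real.zero_rpow (by linarith), sub_zero, sub_zero,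
      mul_div_assoc', e3]
    have h2 : α - 1 ≠ 0 := by linarith
    have h3 : α ≠ 0 := by linarith
    field_simp
    ring
  · exact (intervalIntegrable_iff_integrableOn_Ioc_of_le hf).1 hInt
  · refine (ae_restrict_iff' measurableSet_Ioc).2 (ae_of_all _ fun y hy => ?_)
    have hy0 := hy.1
    have e : y ^ (α - 1) = y ^ (α - 2) * y := by
      rw [← Real.rpow_add_one hy0.ne']; ring_nf
    simp only [Pi.zero_apply]
    rw [e]
    have h2 : 0 ≤ f - y := by linarith [hy.2]
    have h3 : 0 < α - 1 := by linarith
    have : 0 ≤ α * (α - 1) * (y ^ (α - 2) * (f - y)) := by positivity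
    linarith

lemma lintegral_rpow_le_of_integral_max_le {f g : ℝ → ℝ} (hf : Continuous f) (hg : Continuous g)
    (hf0 : ∀ t, 0 ≤ f t) (hg0 : ∀ t, 0 ≤ g t) {τ : ℝ} (hτ : 0 ≤ τ)
    (h : ∀ u, 0 ≤ u →
      ∫ t in (0)..τ, t * max (f t - u) 0 ≤ ∫ t in (0)..τ, t * max (g t - u) 0)
    {α : ℝ} (hα : 1 ≤ α) :
    ∫⁻ t in Ioc 0 τ, ENNReal.ofReal (t * f t ^ α) ≤
      ∫⁻ t in Ioc 0 τ, ENNReal.ofReal (t * g t ^ α) := by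
  have conv : ∀ f : ℝ → ℝ, Continuous f → ∀ u,
      ∫⁻ t in Ioc 0 τ, ENNReal.ofReal (t * max (f t - u) 0) =
        ENNReal.ofReal (∫ t in (0)..τ, t * max (f t - u) 0) := by
    intro f hf u
    rw [intervalIntegral.integral_of_le hτ, ofReal_integral_eq_lintegral_ofReal]
    · exact (intervalIntegrable_iff_integrableOn_Ioc_of_le hτ).1
        (Continuous.intervalIntegrable (by fun_prop) _ _)
    · exact (ae_restrict_iff' measurableSet_Ioc).2 (ae_of_all _ fun y hy =>
        mul_nonneg hy.1.le (le_max_right _ _))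
  rcases hα.eq_or_lt with rfl | hα
  · have h0 := ENNReal.ofReal_le_ofReal (h 0 le_rfl)
    rw [← conv f hf, ← conv g hg] at h0
    simpa [hf0, hg0] using h0
  have cake : ∀ f : ℝ → ℝ, Continuous f → (∀ t, 0 ≤ f t) →
      ∫⁻ t in Ioc 0 τ, ENNReal.ofReal (t * f t ^ α) =
        ∫⁻ y in Ioi (0 : ℝ), ENNReal.ofReal (α * (α - 1) * y ^ (α - 2)) *
          ENNReal.ofReal (∫ t in (0)..τ, t * max (f t - y) 0) := by
    intro f hf hf0
    have e1 : ∀ t ∈ Ioc 0 τ, ENNReal.ofReal (t * f t ^ α) = ∫⁻ y in Ioi (0 : ℝ),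
        ENNReal.ofReal (α * (α - 1) * y ^ (α - 2)) * ENNReal.ofReal (t * max (f t - y) 0) := by
      intro t ht
      rw [ENNReal.ofReal_mul ht.1.le, ← lintegral_layer_cake_max hα (hf0 t),
        ← lintegral_const_mul _ (by fun_prop)]
      refine lintegral_congr fun y => ?_
      rw [ENNReal.ofReal_mul ht.1.le]
      ring
    rw [setLIntegral_congr_fun measurableSet_Ioc e1, lintegral_lintegral_swap]
    · refine lintegral_congr fun y => ?_
      rw [lintegral_const_mul _ (by fun_prop), conv f hf]
    · refine Measurable.aemeasurable ?_
      simp only [Function.uncurry_def]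
      fun_prop
  rw [cake f hf hf0, cake g hg hg0]
  refine setLIntegral_mono' measurableSet_Ioi fun y hy => ?_
  gcongr
  exact h y (le_of_lt hy)

lemma lintegral_rpow_Ioi_of_pos {c t : ℝ} (hc : 0 < c) (ht : 0 < t) :
    ∫⁻ τ in Ici t, ENNReal.ofReal (c * τ ^ (-c - 1)) = ENNReal.ofReal (t ^ (-c)) := by
  rw [setLIntegral_congr Ioi_ae_eq_Ici.symm, ← ofReal_integral_eq_lintegral_ofReal]
  · rw [integral_const_mul, integral_Ioi_rpow_of_lt (by linarith) ht]
    congr 1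
    have : -c - 1 + 1 = -c := by ring
    rw [this]
    field_simp
  · exact (integrableOn_Ioi_rpow_of_lt (by linarith) ht).const_mul c
  · refine (ae_restrict_iff' measurableSet_Ioi).2 (ae_of_all _ fun y hy => ?_)
    have : 0 < y := ht.trans hy
    simp only [Pi.zero_apply]
    positivity

lemma lintegral_weight_le {F G : ℝ → ℝ≥0∞} (hF : Measurable F) (hG : Measurable G)
    (h : ∀ τ, 0 ≤ τ → ∫⁻ t in Ioc 0 τ, F t ≤ ∫⁻ t in Ioc 0 τ, G t) {c : ℝ} (hc : 0 ≤ c) :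
    ∫⁻ t in Ioi 0, ENNReal.ofReal (t ^ (-c)) * F t ≤
      ∫⁻ t in Ioi 0, ENNReal.ofReal (t ^ (-c)) * G t := by
  rcases hc.eq_or_lt with rfl | hc
  · simp only [neg_zero, Real.rpow_zero, ENNReal.ofReal_one, one_mul]
    have hU : Ioi (0 : ℝ) = ⋃ n : ℕ, Ioc 0 (n : ℝ) := by
      ext x
      simp only [mem_Ioi, mem_iUnion, mem_Ioc]
      exact ⟨fun hx => (exists_nat_ge x).imp fun n hn => ⟨hx, hn⟩, fun ⟨_, hx, _⟩ => hx⟩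
    have hd : Directed (· ⊆ ·) fun n : ℕ => Ioc (0 : ℝ) n :=
      Monotone.directed_le fun m n hmn => Ioc_subset_Ioc_right (by exact_mod_cast hmn)
    rw [hU, setLIntegral_iUnion_of_directed _ hd, setLIntegral_iUnion_of_directed _ hd]
    exact iSup_mono fun n => h n (Nat.cast_nonneg n)
  · have key : ∀ F : ℝ → ℝ≥0∞, Measurable F →
        ∫⁻ t in Ioi 0, ENNReal.ofReal (t ^ (-c)) * F t =
          ∫⁻ τ in Ioi (0 : ℝ), ENNReal.ofReal (c * τ ^ (-c - 1)) * ∫⁻ t in Ioc 0 τ, F t := by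
      intro F hF
      have e1 : ∀ t ∈ Ioi (0 : ℝ), ENNReal.ofReal (t ^ (-c)) * F t = ∫⁻ τ in Ioi (0 : ℝ),
          (Ici t).indicator (fun _ => 1) τ * (ENNReal.ofReal (c * τ ^ (-c - 1)) * F t) := by
        intro t ht
        rw [← lintegral_rpow_Ioi_of_pos hc ht, ← lintegral_mul_const _ (by fun_prop),
          ← inter_eq_self_of_subset_left (Ici_subset_Ioi.2 ht),
          ← Measure.restrict_restrict measurableSet_Ici,
          ← lintegral_indicator measurableSet_Ici]
        refine lintegral_congr fun τ => ?_
        rw [inter_eq_self_of_subset_left (Ici_subset_Ioi.2 ht)]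
        by_cases hτ : τ ∈ Ici t <;> simp [hτ]
      have hS : MeasurableSet {x : ℝ × ℝ | x.1 ≤ x.2} :=
        measurableSet_le measurable_fst measurable_snd
      rw [setLIntegral_congr_fun measurableSet_Ioi e1, lintegral_lintegral_swap]
      · refine setLIntegral_congr_fun measurableSet_Ioi fun τ hτ => ?_
        rw [← lintegral_const_mul _ hF,
          ← inter_eq_self_of_subset_left (Ioc_subset_Ioi_self : Ioc 0 τ ⊆ Ioi 0),
          ← Measure.restrict_restrict measurableSet_Ioc,
          ← lintegral_indicator measurableSet_Ioc]
        refine setLIntegral_congr_fun measurableSet_Ioi fun t ht => ?_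
        have ht : 0 < t := ht
        by_cases hτ : t ≤ τ <;> simp [hτ, ht]
      · refine Measurable.aemeasurable ?_
        have : (Function.uncurry fun t τ : ℝ => (Ici t).indicator (fun _ => (1 : ℝ≥0∞)) τ *
          (ENNReal.ofReal (c * τ ^ (-c - 1)) * F t)) = fun x =>
          {x : ℝ × ℝ | x.1 ≤ x.2}.indicator (fun _ => (1 : ℝ≥0∞)) x *
          (ENNReal.ofReal (c * x.2 ^ (-c - 1)) * F x.1) := by
          funext x
          simp [Function.uncurry_def, indicator]
        rw [this]
        have hm : Measurable ({x : ℝ × ℝ | x.1 ≤ x.2}.indicator fun _ => (1 : ℝ≥0∞)) :=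
          measurable_const.indicator hS
        fun_prop
    rw [key F hF, key G hG]
    refine setLIntegral_mono' measurableSet_Ioi fun τ hτ => ?_
    exact mul_le_mul_right (h τ (le_of_lt hτ)) _

namespace IsBesselProfile

variable {j d : ℝ → ℝ}

lemma lintegral_rpow_le (h : IsBesselProfile j d) {q s b : ℝ} (hq : q ≤ 1) (hs : 2 ≤ s)
    (hb : 0 < b) :
    ∫⁻ t in Ioi (0 : ℝ), ENNReal.ofReal (t ^ (2 * q - 1) * |j (b * t)| ^ s) ≤
      ∫⁻ t in Ioi (0 : ℝ), ENNReal.ofReal (t ^ (2 * q - 1) * exp (-(s * b ^ 2 * t ^ 2 / 8))) := by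
  have hj := h.continuous
  have hA : ∀ τ, 0 ≤ τ → ∫⁻ t in Ioc 0 τ, ENNReal.ofReal (t * (j (b * t) ^ 2) ^ (s / 2)) ≤
      ∫⁻ t in Ioc 0 τ, ENNReal.ofReal (t * (exp (-(b * t) ^ 2 / 4)) ^ (s / 2)) := by
    intro τ hτ
    refine lintegral_rpow_le_of_integral_max_le (by fun_prop) (by fun_prop)
      (fun _ => by positivity) (fun _ => by positivity) hτ (fun u hu => ?_) (by linarith)
    have h1 := h.integral_max_sub_le hu (by positivity : 0 ≤ b * τ)
    have sc : ∀ f : ℝ → ℝ, ∫ t in (0)..τ, t * f (b * t) =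
        b⁻¹ * b⁻¹ * ∫ t in (0)..(b * τ), t * f t := by
      intro f
      have h2 := intervalIntegral.integral_comp_mul_left (a := 0) (b := τ)
        (fun t => b⁻¹ * (t * f t)) hb.ne'
      rw [smul_eq_mul, mul_zero, intervalIntegral.integral_const_mul (b := b * τ)] at h2
      rw [mul_assoc, ← h2]
      refine intervalIntegral.integral_congr fun t _ => ?_
      field_simp
    rw [sc (fun t => max (j t ^ 2 - u) 0), sc (fun t => max (exp (-t ^ 2 / 4) - u) 0)]
    gcongr
  have hB := lintegral_weight_le (by fun_prop) (by fun_prop) hA (c := 2 - 2 * q) (by linarith)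
  have e : ∀ x t : ℝ, 0 < t → ENNReal.ofReal (t ^ (-(2 - 2 * q))) * ENNReal.ofReal (t * x) =
      ENNReal.ofReal (t ^ (2 * q - 1) * x) := by
    intro x t ht
    rw [← ENNReal.ofReal_mul (by positivity), ← mul_assoc, ← Real.rpow_add_one ht.ne']
    ring_nf
  have hs0 : 2 * (s / 2) = s := by ring
  refine le_trans (le_of_eq ?_) (hB.trans (le_of_eq ?_))
  · refine setLIntegral_congr_fun measurableSet_Ioi fun t ht => ?_
    rw [e _ t ht, ← sq_abs, ← Real.rpow_natCast, ← Real.rpow_mul (abs_nonneg _),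
      Nat.cast_ofNat, hs0]
  · refine setLIntegral_congr_fun measurableSet_Ioi fun t ht => ?_
    rw [e _ t ht, ← Real.exp_mul]
    ring_nf

end IsBesselProfile

/-- Rotation by the angle `θ` in the plane spanned by the coordinate axes `0` and `i`. -/
noncomputable def planeRotation (i : Fin 4) (hi : i ≠ 0) (θ : ℝ) :
    EuclideanSpace ℝ (Fin 4) ≃ₗᵢ[ℝ] EuclideanSpace ℝ (Fin 4) :=
  LinearIsometry.toLinearIsometryEquiv
    { toFun := fun x => WithLp.toLp 2 fun k =>
        if k = 0 then x 0 * cos θ - x i * sin θ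
        else if k = i then x i * cos θ + x 0 * sin θ else x k
      map_add' := fun x y => by
        ext k
        simp only [PiLp.add_apply]
        split_ifs <;> ring
      map_smul' := fun c x => by
        ext k
        simp only [PiLp.smul_apply, smul_eq_mul, RingHom.id_apply]
        split_ifs <;> ring
      norm_map' := fun x => by
        rw [EuclideanSpace.norm_eq, EuclideanSpace.norm_eq]
        congr 1
        have h := sin_sq_add_cos_sq θ
        fin_cases i
        · exact absurd rfl hi
        · simp [Fin.sum_univ_four]
          linear_combination (x 0 ^ 2 + x 1 ^ 2) * h
        · simp [Fin.sum_univ_four]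
          linear_combination (x 0 ^ 2 + x 2 ^ 2) * h
        · simp [Fin.sum_univ_four]
          linear_combination (x 0 ^ 2 + x 3 ^ 2) * h } rfl

lemma planeRotation_apply_zero (i : Fin 4) (hi : i ≠ 0) (θ : ℝ) (x : EuclideanSpace ℝ (Fin 4)) :
    planeRotation i hi θ x 0 = x 0 * cos θ - x i * sin θ := by
  simp [planeRotation]

lemma planeRotation_apply_self (i : Fin 4) (hi : i ≠ 0) (θ : ℝ) (x : EuclideanSpace ℝ (Fin 4)) :
    planeRotation i hi θ x i = x i * cos θ + x 0 * sin θ := by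
  simp [planeRotation, hi]

namespace IsUniformOnSphere

variable {μ : Measure (EuclideanSpace ℝ (Fin 4))}

lemma ae_norm_eq_one (hμ : IsUniformOnSphere μ) : ∀ᵐ x ∂μ, ‖x‖ = 1 := by
  refine (measure_mono_null (fun x hx => ?_) hμ.1 : μ {x | ¬ ‖x‖ = 1} = 0)
  simpa using hx

lemma ae_sum_sq (hμ : IsUniformOnSphere μ) :
    ∀ᵐ x ∂μ, x 0 ^ 2 + x 1 ^ 2 + x 2 ^ 2 + x 3 ^ 2 = 1 := by
  filter_upwards [hμ.ae_norm_eq_one] with x hx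
  have h := EuclideanSpace.norm_sq_eq x
  rw [hx, Fin.sum_univ_four] at h
  simp only [Real.norm_eq_abs, sq_abs] at h
  linarith

lemma ae_add_sq_le (hμ : IsUniformOnSphere μ) {i : Fin 4} (hi : i ≠ 0) :
    ∀ᵐ x ∂μ, x 0 ^ 2 + x i ^ 2 ≤ 1 := by
  filter_upwards [hμ.ae_sum_sq] with x hx
  fin_cases i
  · exact absurd rfl hi
  all_goals
    simp
    nlinarith [sq_nonneg (x 1), sq_nonneg (x 2), sq_nonneg (x 3)]

lemma ae_abs_le (hμ : IsUniformOnSphere μ) : ∀ᵐ x ∂μ, |x 0| ≤ 1 := by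
  filter_upwards [hμ.ae_add_sq_le (i := 1) (by decide)] with x hx
  rw [← sq_le_one_iff_abs_le_one]
  nlinarith [sq_nonneg (x 1)]

lemma integral_comp (hμ : IsUniformOnSphere μ)
    (Q : EuclideanSpace ℝ (Fin 4) ≃ₗᵢ[ℝ] EuclideanSpace ℝ (Fin 4))
    (f : EuclideanSpace ℝ (Fin 4) → ℝ) : ∫ x, f (Q x) ∂μ = ∫ x, f x ∂μ := by
  conv_rhs => rw [← hμ.2 Q]
  exact (Q.toHomeomorph.measurableEmbedding.integral_map f).symm

lemma integral_deriv_mul_sq (hμ : IsUniformOnSphere μ) [IsProbabilityMeasure μ] {f f' : ℝ → ℝ}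
    (hf : Measurable f) (hf' : Measurable f') {M M' : ℝ} (hM : ∀ u, |u| ≤ 1 → |f u| ≤ M)
    (hM' : ∀ u, |u| ≤ 1 → |f' u| ≤ M') (hd : ∀ u, |u| ≤ 1 → HasDerivAt f (f' u) u)
    {i : Fin 4} (hi : i ≠ 0) :
    Integrable (fun x : EuclideanSpace ℝ (Fin 4) => f' (x 0) * x i ^ 2) μ ∧
    ∫ x, f' (x 0) * x i ^ 2 ∂μ = ∫ x, x 0 * f (x 0) ∂μ := by
  set A : ℝ → EuclideanSpace ℝ (Fin 4) → ℝ := fun θ x => x 0 * cos θ - x i * sin θ with hA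
  set B : ℝ → EuclideanSpace ℝ (Fin 4) → ℝ := fun θ x => x i * cos θ + x 0 * sin θ with hB
  have hM0 : 0 ≤ M := (abs_nonneg _).trans (hM 0 (by simp))
  have hM0' : 0 ≤ M' := (abs_nonneg _).trans (hM' 0 (by simp))
  have hAB : ∀ᵐ x ∂μ, ∀ θ, |A θ x| ≤ 1 ∧ |B θ x| ≤ 1 := by
    filter_upwards [hμ.ae_add_sq_le hi] with x hx θ
    have h : A θ x ^ 2 + B θ x ^ 2 ≤ 1 := by
      have := sin_sq_add_cos_sq θ
      have e : A θ x ^ 2 + B θ x ^ 2 = (x 0 ^ 2 + x i ^ 2) * (sin θ ^ 2 + cos θ ^ 2) := by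
        simp only [hA, hB]; ring
      rw [e, this, mul_one]
      exact hx
    rw [← sq_le_one_iff_abs_le_one, ← sq_le_one_iff_abs_le_one]
    constructor <;> nlinarith [sq_nonneg (A θ x), sq_nonneg (B θ x)]
  have hmA : ∀ θ, Measurable (A θ) := fun θ => by simp only [hA]; fun_prop
  have hmB : ∀ θ, Measurable (B θ) := fun θ => by simp only [hB]; fun_prop
  have hbound : ∀ θ x, |A θ x| ≤ 1 ∧ |B θ x| ≤ 1 → |f (A θ x) * B θ x| ≤ M := by
    intro θ x hx
    rw [abs_mul]
    calc _ ≤ M * 1 := mul_le_mul (hM _ hx.1) hx.2 (abs_nonneg _) hM0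
      _ = M := mul_one M
  have key := hasDerivAt_integral_of_dominated_loc_of_deriv_le (μ := μ) (x₀ := (0 : ℝ))
    (s := univ) (F := fun θ x => f (A θ x) * B θ x)
    (F' := fun θ x => f' (A θ x) * (-B θ x) * B θ x + f (A θ x) * A θ x)
    (bound := fun _ => M' + M) Filter.univ_mem
    (Filter.Eventually.of_forall fun θ => ((hf.comp (hmA θ)).mul (hmB θ)).aestronglyMeasurable)
    (Integrable.of_bound ((hf.comp (hmA 0)).mul (hmB 0)).aestronglyMeasurable M
      (hAB.mono fun x hx => hbound 0 x (hx 0)))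
    (by
      have := hmA 0
      have := hmB 0
      exact Measurable.aestronglyMeasurable (by fun_prop))
    (by
      filter_upwards [hAB] with x hx θ _
      obtain ⟨h1, h2⟩ := hx θ
      rw [Real.norm_eq_abs]
      refine (abs_add_le _ _).trans (add_le_add ?_ ?_)
      · rw [abs_mul, abs_mul, abs_neg]
        calc _ ≤ M' * 1 * 1 := by gcongr; exact hM' _ h1
          _ = M' := by ring
      · rw [abs_mul]
        calc _ ≤ M * 1 := by gcongr; exact hM _ h1
          _ = M := by ring)
    (integrable_const _)
    (by
      filter_upwards [hAB] with x hx θ _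
      obtain ⟨h1, h2⟩ := hx θ
      have hA' : HasDerivAt (fun θ => A θ x) (-B θ x) θ := by
        refine (((hasDerivAt_cos θ).const_mul (x 0)).sub
          ((hasDerivAt_sin θ).const_mul (x i))).congr_deriv ?_
        simp only [hB]; ring
      have hB' : HasDerivAt (fun θ => B θ x) (A θ x) θ := by
        refine (((hasDerivAt_cos θ).const_mul (x i)).add
          ((hasDerivAt_sin θ).const_mul (x 0))).congr_deriv ?_
        simp only [hA]; ring
      exact (((hd _ h1).comp θ hA').mul hB'))
  have hconst : (fun θ => ∫ x, f (A θ x) * B θ x ∂μ) = fun _ => ∫ x, f (x 0) * x i ∂μ := by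
    funext θ
    rw [← hμ.integral_comp (planeRotation i hi θ) fun x => f (x 0) * x i]
    simp only [planeRotation_apply_zero, planeRotation_apply_self, hA, hB]
  have h0 := key.2
  rw [hconst] at h0
  have h1 := (hasDerivAt_const (0 : ℝ) (∫ x, f (x 0) * x i ∂μ)).unique h0
  simp only [hA, hB, cos_zero, sin_zero, mul_one, mul_zero, sub_zero, add_zero] at h1
  have hi1 : Integrable (fun x : EuclideanSpace ℝ (Fin 4) => f' (x 0) * x i ^ 2) μ := by
    refine Integrable.of_bound (Measurable.aestronglyMeasurable (by fun_prop)) M' ?_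
    filter_upwards [hμ.ae_add_sq_le hi, hμ.ae_abs_le] with x hx hx0
    rw [Real.norm_eq_abs, abs_mul, abs_of_nonneg (sq_nonneg (x i))]
    calc _ ≤ M' * 1 := by
          gcongr
          · exact hM' _ hx0
          · nlinarith [sq_nonneg (x 0)]
      _ = M' := by ring
  have hi2 : Integrable (fun x : EuclideanSpace ℝ (Fin 4) => x 0 * f (x 0)) μ := by
    refine Integrable.of_bound (Measurable.aestronglyMeasurable (by fun_prop)) M ?_
    filter_upwards [hμ.ae_abs_le] with x hx0
    rw [Real.norm_eq_abs, abs_mul]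
    calc _ ≤ 1 * M := by
          gcongr
          exact hM _ hx0
      _ = M := by ring
  refine ⟨hi1, ?_⟩
  have e : ∀ x : EuclideanSpace ℝ (Fin 4), f' (x 0) * -x i * x i + f (x 0) * x 0 =
      x 0 * f (x 0) - f' (x 0) * x i ^ 2 := fun x => by ring
  simp only [e] at h1
  rw [integral_sub hi2 hi1] at h1
  linarith

/-- Integration by parts on the sphere `S³` in terms of the first coordinate. -/
lemma integral_deriv_mul (hμ : IsUniformOnSphere μ) [IsProbabilityMeasure μ] {f f' : ℝ → ℝ}
    (hf : Measurable f) (hf' : Measurable f') {M M' : ℝ} (hM : ∀ u, |u| ≤ 1 → |f u| ≤ M)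
    (hM' : ∀ u, |u| ≤ 1 → |f' u| ≤ M') (hd : ∀ u, |u| ≤ 1 → HasDerivAt f (f' u) u) :
    ∫ x, f' (x 0) * (1 - x 0 ^ 2) ∂μ = 3 * ∫ x, x 0 * f (x 0) ∂μ := by
  have h1 := hμ.integral_deriv_mul_sq hf hf' hM hM' hd (i := 1) (by decide)
  have h2 := hμ.integral_deriv_mul_sq hf hf' hM hM' hd (i := 2) (by decide)
  have h3 := hμ.integral_deriv_mul_sq hf hf' hM hM' hd (i := 3) (by decide)
  have e : ∫ x, f' (x 0) * (1 - x 0 ^ 2) ∂μ =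
      ∫ x, f' (x 0) * x 1 ^ 2 + f' (x 0) * x 2 ^ 2 + f' (x 0) * x 3 ^ 2 ∂μ := by
    refine integral_congr_ae ?_
    filter_upwards [hμ.ae_sum_sq] with x hx
    linear_combination (-f' (x 0)) * hx
  have e1 := integral_add (h1.1.add h2.1) h3.1
  simp only [Pi.add_apply] at e1
  rw [e, e1, integral_add h1.1 h2.1, h1.2, h2.2, h3.2]
  ring

lemma isBesselProfile (hμ : IsUniformOnSphere μ) [IsProbabilityMeasure μ] :
    IsBesselProfile (fun t => ∫ x, cos (t * x 0) ∂μ) (fun t => -∫ x, x 0 * sin (t * x 0) ∂μ) := by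
  have hI : ∀ f : EuclideanSpace ℝ (Fin 4) → ℝ, Measurable f → (∀ x, |x 0| ≤ 1 → |f x| ≤ 1) →
      Integrable f μ := fun f hf hb =>
    Integrable.of_bound hf.aestronglyMeasurable 1 (hμ.ae_abs_le.mono hb)
  have hsin : ∀ x y : ℝ, |x| ≤ 1 → |x * sin y| ≤ 1 := fun x y hx => by
    rw [abs_mul]
    exact mul_le_one₀ hx (abs_nonneg _) (abs_sin_le_one _)
  have hcos : ∀ x y : ℝ, |x| ≤ 1 → |x ^ 2 * cos y| ≤ 1 := fun x y hx => by
    rw [abs_mul, abs_of_nonneg (sq_nonneg x)]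
    exact mul_le_one₀ (sq_le_one_iff_abs_le_one x |>.2 hx) (abs_nonneg _) (abs_cos_le_one _)
  refine ⟨fun t => ?_, fun t ht => ?_, ?_, by simp, fun t => ?_⟩
  · have h := hasDerivAt_integral_of_dominated_loc_of_deriv_le (μ := μ) (x₀ := t)
      (s := univ) (F := fun t x => cos (t * x 0)) (F' := fun t x => -(x 0 * sin (t * x 0)))
      (bound := fun _ => 1) Filter.univ_mem
      (Filter.Eventually.of_forall fun t => Measurable.aestronglyMeasurable (by fun_prop))
      (hI _ (by fun_prop) fun x _ => abs_cos_le_one _)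
      (Measurable.aestronglyMeasurable (by fun_prop))
      (hμ.ae_abs_le.mono fun x hx t _ => by
        rw [norm_neg]; exact hsin _ _ hx)
      (integrable_const _)
      (Filter.Eventually.of_forall fun x t _ => by
        refine ((hasDerivAt_mul_const (x 0)).cos).congr_deriv ?_
        ring)
    rw [← integral_neg]
    exact h.2
  · have h := hasDerivAt_integral_of_dominated_loc_of_deriv_le (μ := μ) (x₀ := t)
      (s := univ) (F := fun t x => x 0 * sin (t * x 0)) (F' := fun t x => x 0 ^ 2 * cos (t * x 0))
      (bound := fun _ => 1) Filter.univ_mem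
      (Filter.Eventually.of_forall fun t => Measurable.aestronglyMeasurable (by fun_prop))
      (hI _ (by fun_prop) fun x hx => hsin _ _ hx)
      (Measurable.aestronglyMeasurable (by fun_prop))
      (hμ.ae_abs_le.mono fun x hx t _ => hcos _ _ hx)
      (integrable_const _)
      (Filter.Eventually.of_forall fun x t _ => by
        refine (((hasDerivAt_mul_const (x 0)).sin).const_mul (x 0)).congr_deriv ?_
        ring)
    refine h.2.neg.congr_deriv ?_
    have hs := hμ.integral_deriv_mul (f := fun u => sin (t * u)) (f' := fun u => t * cos (t * u))
      (by fun_prop) (by fun_prop) (M := 1) (M' := |t|) (fun u _ => abs_sin_le_one _)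
      (fun u _ => by
        rw [abs_mul]
        exact mul_le_of_le_one_right (abs_nonneg _) (abs_cos_le_one _))
      (fun u _ => by
        refine ((hasDerivAt_const_mul t).sin).congr_deriv ?_
        ring)
    have e : ∫ x : EuclideanSpace ℝ (Fin 4), t * cos (t * x 0) * (1 - x 0 ^ 2) ∂μ =
        t * ((∫ x, cos (t * x 0) ∂μ) - ∫ x, x 0 ^ 2 * cos (t * x 0) ∂μ) := by
      rw [← integral_sub (hI _ (by fun_prop) fun x _ => abs_cos_le_one _)
        (hI _ (by fun_prop) fun x hx => hcos _ _ hx), ← integral_const_mul]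
      congr 1
      funext x
      ring
    rw [e] at hs
    generalize ∫ x, cos (t * x 0) ∂μ = c0 at *
    generalize ∫ x, x 0 * sin (t * x 0) ∂μ = c1 at *
    generalize ∫ x, x 0 ^ 2 * cos (t * x 0) ∂μ = c2 at *
    field_simp
    linarith
  · refine Continuous.neg (continuous_of_dominated (bound := fun _ => 1)
      (fun t => Measurable.aestronglyMeasurable (by fun_prop))
      (fun t => hμ.ae_abs_le.mono fun x hx => hsin _ _ hx) (integrable_const _)
      (Filter.Eventually.of_forall fun x => by fun_prop))
  · have := integral_mono (μ := μ) (hI (fun x => cos (t * x 0)) (by fun_prop)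
      fun x _ => abs_cos_le_one _) (integrable_const 1) fun x => cos_le_one _
    simpa using this

lemma exists_isometry_map_eq (w : EuclideanSpace ℝ (Fin 4)) :
    ∃ Q : EuclideanSpace ℝ (Fin 4) ≃ₗᵢ[ℝ] EuclideanSpace ℝ (Fin 4),
      Q w = ‖w‖ • EuclideanSpace.single 0 1 :=
  ⟨_, Submodule.reflection_sub (v := w) (by simp [norm_smul])⟩

lemma map_inner (hμ : IsUniformOnSphere μ) (w : EuclideanSpace ℝ (Fin 4)) :
    μ.map (fun x => inner ℝ w x) = μ.map (fun x => ‖w‖ * x 0) := by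
  obtain ⟨Q, hQ⟩ := exists_isometry_map_eq w
  conv_rhs => rw [← hμ.2 Q]
  rw [Measure.map_map (by fun_prop) Q.continuous.measurable]
  congr 1
  funext x
  rw [← Q.inner_map_map w x, hQ]
  simp [inner_smul_left, EuclideanSpace.inner_single_left]

end IsUniformOnSphere

lemma lintegral_rpow_mul_exp_neg_sq {q r : ℝ} (hq : 0 < q) (hr : 0 < r) :
    ∫⁻ t in Ioi (0 : ℝ), ENNReal.ofReal (t ^ (2 * q - 1) * exp (-(r * t ^ 2 / 2))) =
      ENNReal.ofReal (2 ^ (q - 1) * Real.Gamma q) * ENNReal.ofReal (r ^ (-q)) := by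
  have e : ∀ t : ℝ, t ^ (2 * q - 1) * exp (-(r * t ^ 2 / 2)) =
      t ^ (2 * q - 1) * exp (-(r / 2) * t ^ (2 : ℝ)) := fun t => by
    rw [Real.rpow_two]; ring_nf
  simp only [e]
  have hG := Real.Gamma_pos_of_pos hq
  rw [← ofReal_integral_eq_lintegral_ofReal, ← ENNReal.ofReal_mul (by positivity),
    integral_rpow_mul_exp_neg_mul_rpow (by norm_num) (by linarith) (by positivity)]
  · congr 1
    have h1 : -(2 * q - 1 + 1) / 2 = -q := by ring
    have h2 : (2 * q - 1 + 1) / 2 = q := by ring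
    rw [h1, h2, Real.div_rpow hr.le (by norm_num), Real.rpow_neg (by norm_num : (0:ℝ) ≤ 2),
      Real.rpow_sub (by norm_num : (0:ℝ) < 2), Real.rpow_one]
    field_simp
  · exact integrableOn_rpow_mul_exp_neg_mul_rpow (by linarith) (by norm_num) (by positivity)
  · refine (ae_restrict_iff' measurableSet_Ioi).2 (ae_of_all _ fun y hy => ?_)
    have : 0 < y := hy
    simp only [Pi.zero_apply]
    positivity

lemma lintegral_rpow_mul_exp_neg {a r : ℝ} (ha : 0 < a) (hr : 0 < r) :
    ∫⁻ y in Ioi (0 : ℝ), ENNReal.ofReal (y ^ (a - 1) * exp (-(r * y))) =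
      ENNReal.ofReal (r ^ (-a) * Real.Gamma a) := by
  rw [← ofReal_integral_eq_lintegral_ofReal, Real.integral_rpow_mul_exp_neg_mul_Ioi ha hr]
  · rw [one_div, Real.inv_rpow hr.le, Real.rpow_neg hr.le]
  · have h := integrableOn_rpow_mul_exp_neg_mul_rpow (p := 1) (s := a - 1) (b := r)
      (by linarith) (by norm_num) hr
    simpa [neg_mul, IntegrableOn] using h
  · refine (ae_restrict_iff' measurableSet_Ioi).2 (ae_of_all _ fun y hy => ?_)
    have : 0 < y := hy
    simp only [Pi.zero_apply]
    positivity

lemma nnnorm_rpow_neg_eq {E : Type*} [NormedAddCommGroup E] {v : E} (hv : v ≠ 0) (q : ℝ) :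
    (‖v‖₊ : ℝ≥0∞) ^ (-(2 * q)) = ENNReal.ofReal ((‖v‖ ^ 2) ^ (-q)) := by
  have h : 0 < ‖v‖ := norm_pos_iff.2 hv
  rw [← enorm_eq_nnnorm, ← ofReal_norm, ENNReal.ofReal_rpow_of_pos h, ← Real.rpow_natCast,
    ← Real.rpow_mul h.le]
  congr 2
  push_cast
  ring

lemma const_mul_nnnorm_rpow_le {E : Type*} [NormedAddCommGroup E] (v : E) {q : ℝ} (hq : 0 < q) :
    ENNReal.ofReal (2 ^ (q - 1) * Real.Gamma q) * (‖v‖₊ : ℝ≥0∞) ^ (-(2 * q)) ≤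
      ∫⁻ t in Ioi (0 : ℝ), ENNReal.ofReal (t ^ (2 * q - 1) * exp (-(‖v‖ ^ 2 * t ^ 2 / 2))) := by
  have hK : 0 < 2 ^ (q - 1) * Real.Gamma q := mul_pos (by positivity) (Real.Gamma_pos_of_pos hq)
  rcases eq_or_ne v 0 with rfl | hv
  · have h : ∀ ε : ℝ, 0 < ε → ENNReal.ofReal (2 ^ (q - 1) * Real.Gamma q) *
        ENNReal.ofReal (ε ^ (-q)) ≤ ∫⁻ t in Ioi (0 : ℝ),
        ENNReal.ofReal (t ^ (2 * q - 1) * exp (-(‖(0 : E)‖ ^ 2 * t ^ 2 / 2))) := by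
      intro ε hε
      rw [← lintegral_rpow_mul_exp_neg_sq hq hε]
      refine setLIntegral_mono' measurableSet_Ioi fun t ht => ENNReal.ofReal_le_ofReal ?_
      have ht : 0 < t := ht
      simp only [norm_zero]
      gcongr
      simpa using hε.le
    refine le_top.trans_eq ?_
    refine (ENNReal.eq_top_of_forall_nnreal_le fun M => ?_).symm
    have h2 := h (((M + 1) / (2 ^ (q - 1) * Real.Gamma q)) ^ (-q⁻¹)) (by positivity)
    rw [← ENNReal.ofReal_mul hK.le, ← Real.rpow_mul (by positivity)] at h2
    have e : -q⁻¹ * -q = 1 := by field_simp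
    rw [e, Real.rpow_one, mul_div_cancel₀ _ hK.ne'] at h2
    refine le_trans ?_ h2
    rw [← ENNReal.ofReal_coe_nnreal]
    exact ENNReal.ofReal_le_ofReal (by linarith)
  · rw [lintegral_rpow_mul_exp_neg_sq hq (by positivity), nnnorm_rpow_neg_eq hv]

/-- Four-dimensional Gaussian integral of `exp (-c ‖w‖²)`. -/
lemma integral_exp_neg_sq_stdGaussian {c : ℝ} (hc : 0 ≤ c) :
    ∫ w, exp (-(c * ‖w‖ ^ 2)) ∂(ProbabilityTheory.stdGaussian (EuclideanSpace ℝ (Fin 4))) =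
      ((1 + 2 * c) ^ 2)⁻¹ := by
  rw [← ProbabilityTheory.map_pi_eq_stdGaussian, integral_map
    (Measurable.aemeasurable (by fun_prop)) (Continuous.aestronglyMeasurable (by fun_prop))]
  have e : ∀ x : Fin 4 → ℝ, exp (-(c * ‖(WithLp.toLp 2 x : EuclideanSpace ℝ (Fin 4))‖ ^ 2)) =
      ∏ i, exp (-(c * x i ^ 2)) := by
    intro x
    rw [EuclideanSpace.norm_sq_eq, ← exp_sum, Finset.mul_sum, Finset.sum_neg_distrib]
    simp
  simp only [e]
  rw [integral_fintype_prod_eq_prod (𝕜 := ℝ) (f := fun (_ : Fin 4) (y : ℝ) => exp (-(c * y ^ 2)))]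
  have e1 : ∫ y, exp (-(c * y ^ 2)) ∂(ProbabilityTheory.gaussianReal 0 1) = (√(1 + 2 * c))⁻¹ := by
    rw [ProbabilityTheory.integral_gaussianReal_eq_integral_smul (by norm_num)]
    have e2 : ∀ y, ProbabilityTheory.gaussianPDFReal 0 1 y • exp (-(c * y ^ 2)) =
        (√(2 * π))⁻¹ * exp (-(c + 1 / 2) * y ^ 2) := by
      intro y
      simp only [ProbabilityTheory.gaussianPDFReal, NNReal.coe_one, mul_one, sub_zero, smul_eq_mul]
      rw [mul_assoc, ← exp_add]
      ring_nf
    simp only [e2]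
    rw [integral_const_mul, integral_gaussian, ← Real.sqrt_inv, ← Real.sqrt_inv,
      ← Real.sqrt_mul (by positivity)]
    congr 1
    have := pi_pos
    field_simp
    ring
  simp only [e1, Finset.prod_const, Finset.card_univ, Fintype.card_fin]
  rw [inv_pow]
  congr 1
  rw [show 4 = 2 * 2 by norm_num, pow_mul, Real.sq_sqrt (by positivity)]

lemma lintegral_exp_neg_sq_stdGaussian {c : ℝ} (hc : 0 ≤ c) :
    ∫⁻ w, ENNReal.ofReal (exp (-(c * ‖w‖ ^ 2)))
      ∂(ProbabilityTheory.stdGaussian (EuclideanSpace ℝ (Fin 4))) =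
      ENNReal.ofReal (((1 + 2 * c) ^ 2)⁻¹) := by
  rw [← integral_exp_neg_sq_stdGaussian hc, ofReal_integral_eq_lintegral_ofReal]
  · refine Integrable.of_bound (Continuous.aestronglyMeasurable (by fun_prop)) 1
      (ae_of_all _ fun w => ?_)
    rw [Real.norm_eq_abs, abs_of_pos (exp_pos _), exp_le_one_iff]
    have : 0 ≤ c * ‖w‖ ^ 2 := by positivity
    linarith
  · exact ae_of_all _ fun w => (exp_pos _).le

lemma lintegral_nnnorm_rpow_stdGaussian_le {q : ℝ} (hq : 0 < q) (hq1 : q ≤ 1) :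
    ∫⁻ w, (‖w‖₊ : ℝ≥0∞) ^ (-(2 * q))
      ∂(ProbabilityTheory.stdGaussian (EuclideanSpace ℝ (Fin 4))) ≤
      ENNReal.ofReal (2 ^ (-q) * Real.Gamma (2 - q)) := by
  set K := ENNReal.ofReal (2 ^ (q - 1) * Real.Gamma q) with hK
  have hK0 : K ≠ 0 := by
    have : 0 < 2 ^ (q - 1) * Real.Gamma q := mul_pos (by positivity) (Real.Gamma_pos_of_pos hq)
    simpa [hK] using this
  have hKt : K ≠ ⊤ := ENNReal.ofReal_ne_top
  refine (ENNReal.mul_le_mul_iff_right hK0 hKt).1 ?_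
  rw [← lintegral_const_mul _ (by fun_prop)]
  calc _ ≤ ∫⁻ w, (∫⁻ t in Ioi (0 : ℝ),
          ENNReal.ofReal (t ^ (2 * q - 1) * exp (-(‖w‖ ^ 2 * t ^ 2 / 2))))
          ∂(ProbabilityTheory.stdGaussian (EuclideanSpace ℝ (Fin 4))) :=
        lintegral_mono fun w => const_mul_nnnorm_rpow_le w hq
    _ = ∫⁻ t in Ioi (0 : ℝ), ENNReal.ofReal (t ^ (2 * q - 1)) *
          ENNReal.ofReal (((1 + t ^ 2) ^ 2)⁻¹) := by
        rw [lintegral_lintegral_swap (Measurable.aemeasurable (by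
          simp only [Function.uncurry_def]; fun_prop))]
        refine setLIntegral_congr_fun measurableSet_Ioi fun t ht => ?_
        have ht : 0 < t := ht
        have e := lintegral_exp_neg_sq_stdGaussian (c := t ^ 2 / 2) (by positivity)
        rw [show 1 + 2 * (t ^ 2 / 2) = 1 + t ^ 2 by ring] at e
        rw [← e, ← lintegral_const_mul _ (by fun_prop)]
        refine lintegral_congr fun w => ?_
        rw [← ENNReal.ofReal_mul (by positivity)]
        ring_nf
    _ = ∫⁻ t in Ioi (0 : ℝ), ∫⁻ y in Ioi (0 : ℝ), ENNReal.ofReal (y * exp (-y)) *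
          ENNReal.ofReal (t ^ (2 * q - 1) * exp (-(2 * y * t ^ 2 / 2))) := by
        refine setLIntegral_congr_fun measurableSet_Ioi fun t ht => ?_
        have ht : 0 < t := ht
        have e := lintegral_rpow_mul_exp_neg (a := 2) (r := 1 + t ^ 2) (by norm_num) (by positivity)
        rw [Real.Gamma_two, mul_one, Real.rpow_neg (by positivity), Real.rpow_two] at e
        rw [← e, ← lintegral_const_mul _ (by fun_prop)]
        refine setLIntegral_congr_fun measurableSet_Ioi fun y hy => ?_
        have hy : 0 < y := hy
        rw [← ENNReal.ofReal_mul (by positivity), ← ENNReal.ofReal_mul (by positivity)]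
        congr 1
        rw [show (2 : ℝ) - 1 = 1 by norm_num, Real.rpow_one,
          show -((1 + t ^ 2) * y) = -y + -(2 * y * t ^ 2 / 2) by ring, exp_add]
        ring
    _ = ∫⁻ y in Ioi (0 : ℝ), ENNReal.ofReal (y * exp (-y)) *
          (K * ENNReal.ofReal ((2 * y) ^ (-q))) := by
        rw [lintegral_lintegral_swap (Measurable.aemeasurable (by
          simp only [Function.uncurry_def]; fun_prop))]
        refine setLIntegral_congr_fun measurableSet_Ioi fun y hy => ?_
        have hy : 0 < y := hy
        rw [lintegral_const_mul _ (by fun_prop), lintegral_rpow_mul_exp_neg_sq hq (by positivity)]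
    _ = K * ∫⁻ y in Ioi (0 : ℝ), ENNReal.ofReal (2 ^ (-q)) *
          ENNReal.ofReal (y ^ (2 - q - 1) * exp (-(1 * y))) := by
        rw [← lintegral_const_mul _ (by fun_prop)]
        refine setLIntegral_congr_fun measurableSet_Ioi fun y hy => ?_
        have hy : 0 < y := hy
        rw [mul_left_comm]
        congr 1
        rw [← ENNReal.ofReal_mul (by positivity), ← ENNReal.ofReal_mul (by positivity)]
        congr 1
        rw [Real.mul_rpow (by norm_num) hy.le, show 2 - q - 1 = -q + 1 by ring,
          Real.rpow_add_one hy.ne', one_mul]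
        ring
    _ = _ := by
        rw [lintegral_const_mul _ (by fun_prop), lintegral_rpow_mul_exp_neg (by linarith) one_pos,
          Real.one_rpow, one_mul, ← ENNReal.ofReal_mul (by positivity)]

lemma IsBesselProfile.lintegral_prod_le {j d : ℝ → ℝ} (h : IsBesselProfile j d)
    {ι : Type*} [Fintype ι] {a : ι → ℝ} (ha : ∀ i, 0 ≤ a i) {S : ℝ} (hS : 0 < S)
    (hsum : ∑ i, a i ^ 2 = S) (hhalf : ∀ i, 2 * a i ^ 2 ≤ S) {q : ℝ} (hq : q ≤ 1)
    {r : ℝ} (hr : 0 ≤ r) :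
    ∫⁻ t in Ioi (0 : ℝ), ENNReal.ofReal (t ^ (2 * q - 1) * ∏ i, |j (a i * (t * r))|) ≤
      ∫⁻ t in Ioi (0 : ℝ),
        ENNReal.ofReal (t ^ (2 * q - 1) * exp (-(S / 4 * r ^ 2 * t ^ 2 / 2))) := by
  rcases hr.eq_or_lt with rfl | hr
  · simp [h.map_zero]
  have hj : Measurable j := h.continuous.measurable
  set p : ι → ℝ := fun i => a i ^ 2 / S with hp
  have hp0 : ∀ i, 0 ≤ p i := fun i => by positivity
  have hp1 : ∑ i, p i = 1 := by rw [hp, ← Finset.sum_div, hsum, div_self hS.ne']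
  set f : ι → ℝ → ℝ≥0∞ := fun i t =>
    ENNReal.ofReal (t ^ (2 * q - 1) * |j (a i * r * t)| ^ (S / a i ^ 2)) with hf
  set G := ∫⁻ t in Ioi (0 : ℝ),
    ENNReal.ofReal (t ^ (2 * q - 1) * exp (-(S / 4 * r ^ 2 * t ^ 2 / 2))) with hG
  calc _ = ∫⁻ t in Ioi (0 : ℝ), ∏ i, f i t ^ p i := by
        refine setLIntegral_congr_fun measurableSet_Ioi fun t ht => ?_
        have ht : 0 < t := ht
        have e : ∀ i, f i t ^ p i =
            ENNReal.ofReal ((t ^ (2 * q - 1)) ^ p i * |j (a i * (t * r))|) := by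
          intro i
          simp only [hf]
          rw [ENNReal.ofReal_rpow_of_nonneg (by positivity) (hp0 i),
            Real.mul_rpow (by positivity) (by positivity), ← Real.rpow_mul (abs_nonneg _)]
          congr 2
          rcases (ha i).eq_or_lt with h0 | h0
          · simp [← h0, h.map_zero]
          · have : S / a i ^ 2 * p i = 1 := by simp only [hp]; field_simp
            rw [this, Real.rpow_one, mul_assoc, mul_comm r]
        simp only [e]
        rw [← ENNReal.ofReal_prod_of_nonneg fun i _ => by positivity, Finset.prod_mul_distrib,
          ← Real.rpow_sum_of_pos (by positivity), hp1, Real.rpow_one]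
    _ ≤ ∏ i, (∫⁻ t in Ioi (0 : ℝ), f i t) ^ p i :=
        ENNReal.lintegral_prod_norm_pow_le _
          (fun i _ => Measurable.aemeasurable (by simp only [hf]; fun_prop)) hp1 fun i _ => hp0 i
    _ ≤ ∏ i, G ^ p i := by
        refine Finset.prod_le_prod' fun i _ => ?_
        rcases (ha i).eq_or_lt with h0 | h0
        · simp [hp, ← h0]
        · refine ENNReal.rpow_le_rpow ?_ (hp0 i)
          have hs : 2 ≤ S / a i ^ 2 := by rw [le_div_iff₀ (by positivity)]; exact hhalf i
          refine (h.lintegral_rpow_le hq hs (mul_pos h0 hr)).trans_eq ?_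
          rw [hG]
          congr! 6 with t
          field_simp
          ring
    _ = G := by
        have : ∀ s : Finset ι, ∏ i ∈ s, G ^ p i = G ^ ∑ i ∈ s, p i := by
          classical
          intro s
          induction s using Finset.induction_on with
          | empty => simp
          | insert i s hi ih =>
            rw [Finset.prod_insert hi, Finset.sum_insert hi, ih,
              ENNReal.rpow_add_of_nonneg _ _ (hp0 i) (Finset.sum_nonneg fun k _ => hp0 k)]
        rw [this, hp1, ENNReal.rpow_one]

/-- Parseval's identity against a Gaussian. -/
lemma integral_exp_neg_sq_eq_integral_charFun {E : Type*} [NormedAddCommGroup E]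
    [InnerProductSpace ℝ E] [FiniteDimensional ℝ E] [MeasurableSpace E] [BorelSpace E]
    (ρ : Measure E) [IsProbabilityMeasure ρ] (t : ℝ) :
    ((∫ v, exp (-(‖v‖ ^ 2 * t ^ 2 / 2)) ∂ρ : ℝ) : ℂ) =
      ∫ w, charFun ρ (t • w) ∂(ProbabilityTheory.stdGaussian E) := by
  have e : ∀ v : E, ((exp (-(‖v‖ ^ 2 * t ^ 2 / 2)) : ℝ) : ℂ) =
      ∫ w, Complex.exp (inner ℝ w (t • v) * Complex.I) ∂(ProbabilityTheory.stdGaussian E) := by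
    intro v
    rw [← charFun_apply, ProbabilityTheory.charFun_stdGaussian, ← Complex.ofReal_pow, norm_smul,
      mul_pow, Real.norm_eq_abs, sq_abs]
    push_cast
    ring_nf
  rw [← integral_complex_ofReal]
  simp only [e, charFun_apply]
  rw [integral_integral_swap]
  · simp only [inner_smul_right, real_inner_comm]
  · refine Integrable.of_bound (Continuous.aestronglyMeasurable (by
      simp only [Function.uncurry_def]; fun_prop)) 1 (ae_of_all _ fun w => ?_)
    simp [Function.uncurry_def, Complex.norm_exp_ofReal_mul_I]

/-- Negative moments of a measure with Bessel product characteristic function, none of whose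
factors carries more than half of the total variance. -/
lemma IsBesselProfile.lintegral_nnnorm_rpow_le {j d : ℝ → ℝ} (h : IsBesselProfile j d)
    {ρ : Measure (EuclideanSpace ℝ (Fin 4))} [IsProbabilityMeasure ρ]
    {ι : Type*} [Fintype ι] {a : ι → ℝ} (ha : ∀ i, 0 ≤ a i) {S : ℝ} (hS : 0 < S)
    (hsum : ∑ i, a i ^ 2 = S) (hhalf : ∀ i, 2 * a i ^ 2 ≤ S)
    (hchar : ∀ w, charFun ρ w = ((∏ i, j (a i * ‖w‖) : ℝ) : ℂ))
    {q : ℝ} (hq0 : 0 < q) (hq : q ≤ 1) :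
    ∫⁻ v, (‖v‖₊ : ℝ≥0∞) ^ (-(2 * q)) ∂ρ ≤
      ENNReal.ofReal (2 ^ q * Real.Gamma (2 - q) * S ^ (-q)) := by
  set γ := ProbabilityTheory.stdGaussian (EuclideanSpace ℝ (Fin 4)) with hγ
  obtain ⟨K, hK⟩ : ∃ K, K = ENNReal.ofReal (2 ^ (q - 1) * Real.Gamma q) := ⟨_, rfl⟩
  have hK0 : K ≠ 0 := by
    have : 0 < 2 ^ (q - 1) * Real.Gamma q := mul_pos (by positivity) (Real.Gamma_pos_of_pos hq0)
    simpa [hK] using this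
  have hKt : K ≠ ⊤ := hK ▸ ENNReal.ofReal_ne_top
  have hj : Measurable j := h.continuous.measurable
  have hjc : Continuous j := h.continuous
  have hfix : ∀ t : ℝ, 0 < t → ∫⁻ v, ENNReal.ofReal (exp (-(‖v‖ ^ 2 * t ^ 2 / 2))) ∂ρ ≤
      ∫⁻ w, ENNReal.ofReal (∏ i, |j (a i * (t * ‖w‖))|) ∂γ := by
    intro t ht
    have e := integral_exp_neg_sq_eq_integral_charFun ρ t
    simp only [hchar] at e
    rw [integral_complex_ofReal, Complex.ofReal_inj] at e
    rw [← ofReal_integral_eq_lintegral_ofReal, e]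
    · refine ((Real.ofReal_le_enorm _).trans (enorm_integral_le_lintegral_enorm _)).trans_eq ?_
      refine lintegral_congr fun w => ?_
      rw [Real.enorm_eq_ofReal_abs, Finset.abs_prod, norm_smul, Real.norm_eq_abs, abs_of_pos ht]
    · refine Integrable.of_bound (Continuous.aestronglyMeasurable (by fun_prop)) 1
        (ae_of_all _ fun w => ?_)
      rw [Real.norm_eq_abs, abs_of_pos (exp_pos _), exp_le_one_iff]
      have : 0 ≤ ‖w‖ ^ 2 * t ^ 2 / 2 := by positivity
      linarith
    · exact ae_of_all _ fun w => (exp_pos _).le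
  refine (ENNReal.mul_le_mul_iff_right hK0 hKt).1 ?_
  rw [← lintegral_const_mul _ (by fun_prop)]
  calc _ ≤ ∫⁻ v, (∫⁻ t in Ioi (0 : ℝ),
          ENNReal.ofReal (t ^ (2 * q - 1) * exp (-(‖v‖ ^ 2 * t ^ 2 / 2)))) ∂ρ :=
        lintegral_mono fun v => hK ▸ const_mul_nnnorm_rpow_le v hq0
    _ = ∫⁻ t in Ioi (0 : ℝ), ENNReal.ofReal (t ^ (2 * q - 1)) *
          ∫⁻ v, ENNReal.ofReal (exp (-(‖v‖ ^ 2 * t ^ 2 / 2))) ∂ρ := by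
        rw [lintegral_lintegral_swap (Measurable.aemeasurable (by
          simp only [Function.uncurry_def]; fun_prop))]
        refine setLIntegral_congr_fun measurableSet_Ioi fun t ht => ?_
        have ht : 0 < t := ht
        rw [← lintegral_const_mul _ (by fun_prop)]
        refine lintegral_congr fun w => ?_
        rw [← ENNReal.ofReal_mul (by positivity)]
    _ ≤ ∫⁻ t in Ioi (0 : ℝ), ENNReal.ofReal (t ^ (2 * q - 1)) *
          ∫⁻ w, ENNReal.ofReal (∏ i, |j (a i * (t * ‖w‖))|) ∂γ := by
        refine setLIntegral_mono' measurableSet_Ioi fun t ht => ?_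
        exact mul_le_mul_right (hfix t ht) _
    _ = ∫⁻ w, (∫⁻ t in Ioi (0 : ℝ),
          ENNReal.ofReal (t ^ (2 * q - 1) * ∏ i, |j (a i * (t * ‖w‖))|)) ∂γ := by
        rw [lintegral_lintegral_swap (Measurable.aemeasurable (by
          simp only [Function.uncurry_def]; fun_prop))]
        refine setLIntegral_congr_fun measurableSet_Ioi fun t ht => ?_
        have ht : 0 < t := ht
        rw [← lintegral_const_mul _ (by fun_prop)]
        refine lintegral_congr fun w => ?_
        rw [← ENNReal.ofReal_mul (by positivity)]
    _ ≤ ∫⁻ w, K * (ENNReal.ofReal ((S / 4) ^ (-q)) * (‖w‖₊ : ℝ≥0∞) ^ (-(2 * q))) ∂γ := by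
        refine lintegral_mono fun w => ?_
        rcases eq_or_ne w 0 with rfl | hw
        · have h1 : ENNReal.ofReal ((S / 4) ^ (-q)) ≠ 0 := by
            have : 0 < (S / 4) ^ (-q) := by positivity
            simpa using this
          simp [hq0, ENNReal.mul_top h1, ENNReal.mul_top hK0]
        have hw' : 0 < ‖w‖ := norm_pos_iff.2 hw
        refine (h.lintegral_prod_le ha hS hsum hhalf hq (norm_nonneg w)).trans_eq ?_
        rw [lintegral_rpow_mul_exp_neg_sq hq0 (by positivity), nnnorm_rpow_neg_eq hw, hK,
          ← ENNReal.ofReal_mul (p := (S / 4) ^ (-q)) (by positivity),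
          Real.mul_rpow (by positivity) (by positivity)]
    _ ≤ K * (ENNReal.ofReal ((S / 4) ^ (-q)) *
          ENNReal.ofReal (2 ^ (-q) * Real.Gamma (2 - q))) := by
        rw [lintegral_const_mul _ (by fun_prop), lintegral_const_mul _ (by fun_prop)]
        gcongr
        exact lintegral_nnnorm_rpow_stdGaussian_le hq0 hq
    _ = _ := by
        congr 1
        rw [← ENNReal.ofReal_mul (by positivity)]
        congr 1
        rw [Real.div_rpow hS.le (by norm_num), show (4:ℝ) = 2 * 2 by norm_num,
          Real.mul_rpow (by norm_num) (by norm_num), Real.rpow_neg (by norm_num : (0:ℝ) ≤ 2)]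
        field_simp

lemma log_one_sub_div_add_le {q c z₀ z : ℝ} (hq0 : 0 ≤ q) (hq1 : q ≤ 1) (hc0 : 0 ≤ c)
    (hz₀ : 2 ≤ z₀) (hz : z₀ ≤ z) (hc : ∀ y, z₀ ≤ y → y * (y - q) ≤ (y + c) * (y - 1 + c)) :
    log (1 - q / z) + q * (log (z + c) - log (z - 1 + c)) ≤ 0 := by
  have hpos : ∀ y, z₀ ≤ y → 0 < 1 - q / y := by
    intro y hy
    have : q / y < 1 := by rw [div_lt_one (by linarith)]; linarith
    linarith
  have hmono : ∀ Z, z ≤ Z → log (1 - q / z) + q * (log (z + c) - log (z - 1 + c)) ≤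
      log (1 - q / Z) + q * (log (Z + c) - log (Z - 1 + c)) := by
    intro Z hZ
    have hd : ∀ y, z₀ ≤ y → HasDerivAt
        (fun y => log (1 - q / y) + q * (log (y + c) - log (y - 1 + c)))
        (q / (y * (y - q)) - q / ((y + c) * (y - 1 + c))) y := by
      intro y hy
      have h0 : y ≠ 0 := by linarith
      have h1 : HasDerivAt (fun y => 1 - q / y) (q / y ^ 2) y := by
        refine (((hasDerivAt_const y q).div (hasDerivAt_id y) h0).const_sub 1).congr_deriv ?_
        simp only [id_eq]
        ring
      have h2 : HasDerivAt (fun y => y + c) 1 y := (hasDerivAt_id y).add_const c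
      have h3 : HasDerivAt (fun y => y - 1 + c) 1 y := ((hasDerivAt_id y).sub_const 1).add_const c
      have h4 : y + c ≠ 0 := by linarith
      have h5 : y - 1 + c ≠ 0 := by linarith
      have h6 : y - q ≠ 0 := by linarith
      refine ((h1.log (hpos y hy).ne').add
        (((h2.log h4).sub (h3.log h5)).const_mul q)).congr_deriv ?_
      have h7 : 1 - q / y = (y - q) / y := by field_simp
      rw [h7]
      field_simp
      ring
    refine le_of_hasDerivAt_nonneg hZ
      (fun y hy => (hd y (hz.trans hy.1)).continuousAt.continuousWithinAt)
      (fun y hy => hd y (hz.trans hy.1.le)) fun y hy => ?_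
    have hy' : z₀ ≤ y := hz.trans hy.1.le
    rw [sub_nonneg]
    have : 0 < y * (y - q) := mul_pos (by linarith) (by linarith)
    exact div_le_div_of_nonneg_left hq0 this (hc y hy')
  refine le_of_forall_pos_le_add fun ε hε => ?_
  rw [zero_add]
  set Z := max z (1 + 1 / ε) with hZ
  have hZ1 : 1 + 1 / ε ≤ Z := le_max_right _ _
  have hZz : z ≤ Z := le_max_left _ _
  refine (hmono Z hZz).trans ?_
  have hZ0 : 0 < Z - 1 := by linarith
  have h1 : log (1 - q / Z) ≤ 0 :=
    log_nonpos (hpos Z (hz.trans hZz)).le (by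
      have : 0 ≤ q / Z := div_nonneg hq0 (by linarith)
      linarith)
  have h2 : log (Z + c) - log (Z - 1 + c) ≤ 1 / (Z - 1 + c) := by
    rw [← log_div (by linarith) (by linarith)]
    refine (log_le_sub_one_of_pos (div_pos (by linarith) (by linarith))).trans_eq ?_
    have : Z - 1 + c ≠ 0 := by linarith
    field_simp
    ring
  have h3 : 1 / (Z - 1 + c) ≤ ε := by
    rw [div_le_iff₀ (by linarith)]
    have : 1 ≤ ε * (Z - 1) := by
      have : 1 / ε ≤ Z - 1 := by linarith
      rwa [div_le_iff₀ hε, mul_comm] at this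
    nlinarith
  nlinarith

/-- A sharp lower bound for the Gamma function just below an integer. -/
lemma factorial_mul_rpow_le_Gamma {q : ℝ} (hq0 : 0 < q) (hq1 : q ≤ 1) (N : ℕ) :
    ((N + 1).factorial : ℝ) * (N + 1 + (1 - q) * (1 / 2 + 1 / (4 * N + 6))) ^ (-q) ≤
      Real.Gamma (N + 2 - q) := by
  obtain ⟨c, hc⟩ : ∃ c, c = (1 - q) * (1 / 2 + 1 / (4 * (N : ℝ) + 6)) := ⟨_, rfl⟩
  rw [← hc]
  have hN : (0:ℝ) ≤ N := Nat.cast_nonneg N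
  have hδ : 1 / (4 * (N : ℝ) + 6) ≤ 1 / 6 := by
    gcongr; linarith
  have hδ0 : 0 < 1 / (4 * (N : ℝ) + 6) := by positivity
  have hc0 : 0 ≤ c := by rw [hc]; exact mul_nonneg (by linarith) (by linarith)
  have hc1 : c ≤ 1 := by rw [hc]; nlinarith
  have hquad : ∀ y, (N : ℝ) + 2 ≤ y → y * (y - q) ≤ (y + c) * (y - 1 + c) := by
    intro y hy
    have e1 : 1 / 2 + 1 / (4 * (N : ℝ) + 6) ≤ 2 * (1 / (4 * (N : ℝ) + 6)) * y := by
      have : (4 * (N : ℝ) + 6) ≠ 0 := by positivity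
      have e2 : 1 / 2 + 1 / (4 * (N : ℝ) + 6) = 2 * (1 / (4 * (N : ℝ) + 6)) * (N + 2) := by
        field_simp; ring
      rw [e2]; gcongr
    have e3 : c * (1 - c) ≤ 2 * (1 / (4 * (N : ℝ) + 6)) * y * (1 - q) := by
      have : c ≤ 2 * (1 / (4 * (N : ℝ) + 6)) * y * (1 - q) := by
        rw [hc, mul_comm (1 - q)]
        exact mul_le_mul_of_nonneg_right e1 (by linarith)
      nlinarith
    have e4 : 2 * c - 1 + q = 2 * (1 / (4 * (N : ℝ) + 6)) * (1 - q) := by rw [hc]; ring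
    nlinarith
  set D : ℕ → ℝ := fun M => Real.Gamma (M + 2 - q) / (M + 1).factorial * (M + 1 + c) ^ q with hD
  have hstep : ∀ M, N ≤ M → D (M + 1) ≤ D M := by
    intro M hM
    have hM' : (N : ℝ) ≤ M := by exact_mod_cast hM
    have h := log_one_sub_div_add_le (z₀ := N + 2) (z := M + 2) hq0.le hq1 hc0 (by linarith)
      (by linarith) hquad
    have hp : 0 < 1 - q / ((M : ℝ) + 2) := by
      have : q / ((M : ℝ) + 2) < 1 := by rw [div_lt_one (by linarith)]; linarith
      linarith
    have h1 : (1 - q / ((M : ℝ) + 2)) * ((M + 2 + c) ^ q / (M + 1 + c) ^ q) ≤ 1 := by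
      refine le_trans (le_of_eq ?_) (Real.exp_le_one_iff.2 h)
      rw [exp_add, exp_log hp, mul_sub, exp_sub, Real.rpow_def_of_pos (by linarith),
        Real.rpow_def_of_pos (by linarith), show (M : ℝ) + 2 - 1 + c = M + 1 + c by ring]
      ring_nf
    simp only [hD]
    have hG : Real.Gamma ((M + 1 : ℕ) + 2 - q) = (M + 2 - q) * Real.Gamma (M + 2 - q) := by
      rw [← Real.Gamma_add_one (by linarith)]
      congr 1; push_cast; ring
    have hG0 : 0 < Real.Gamma (M + 2 - q) := Real.Gamma_pos_of_pos (by linarith)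
    rw [hG, Nat.factorial_succ (M + 1)]
    have hp1 : (0:ℝ) < (M + 1 + c) ^ q := by positivity
    have hf : (0:ℝ) < (M + 1).factorial := by positivity
    have h2 := mul_le_mul_of_nonneg_left h1
      (show 0 ≤ Real.Gamma (M + 2 - q) / (M + 1).factorial * (M + 1 + c) ^ q by positivity)
    rw [mul_one] at h2
    refine le_trans (le_of_eq ?_) h2
    push_cast
    rw [show (M : ℝ) + 1 + 1 + c = M + 2 + c by ring, show (M : ℝ) + 1 + 1 = M + 2 by ring]
    field_simp
  have hlow : ∀ M : ℕ, ((M : ℝ) + 1) / (M + 2) ≤ D M := by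
    intro M
    have hM : (0:ℝ) ≤ M := Nat.cast_nonneg M
    have hG0 : 0 < Real.Gamma (M + 2 - q) := Real.Gamma_pos_of_pos (by linarith)
    have hfac : Real.Gamma (M + 2) = (M + 1).factorial := by
      rw [← Real.Gamma_nat_eq_factorial]; congr 1; push_cast; ring
    have h1 : ((M + 1).factorial : ℝ) ≤ Real.Gamma (M + 2 - q) * (M + 2 - q) ^ q := by
      rcases hq1.eq_or_lt with rfl | hq1
      · rw [Real.rpow_one, mul_comm, ← Real.Gamma_add_one (by linarith), ← hfac]
        simp
      · have := Real.Gamma_mul_add_mul_le_rpow_Gamma_mul_rpow_Gamma (s := M + 2 - q)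
          (t := M + 2 - q + 1) (a := 1 - q) (b := q) (by linarith) (by linarith) (by linarith) hq0
          (by ring)
        rw [Real.Gamma_add_one (by linarith),
          show (1 - q) * ((M : ℝ) + 2 - q) + q * (M + 2 - q + 1) = M + 2 by ring, hfac,
          Real.mul_rpow (by linarith) hG0.le, mul_left_comm, ← Real.rpow_add hG0] at this
        simpa [mul_comm] using this
    have h2 : ((M : ℝ) + 2 - q) ^ q ≤ (M + 2) ^ q :=
      Real.rpow_le_rpow (by linarith) (by linarith) hq0.le
    have h3 : ((M : ℝ) + 1) / (M + 2) ≤ (((M : ℝ) + 1) / (M + 2)) ^ q := by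
      refine Real.self_le_rpow_of_le_one (by positivity) ?_ hq1
      rw [div_le_one (by positivity)]; linarith
    rw [Real.div_rpow (by positivity) (by positivity)] at h3
    refine h3.trans ?_
    simp only [hD]
    have h4 : ((M : ℝ) + 1) ^ q ≤ (M + 1 + c) ^ q :=
      Real.rpow_le_rpow (by linarith) (by linarith) hq0.le
    rw [div_le_iff₀ (by positivity), div_mul_eq_mul_div, div_mul_eq_mul_div,
      le_div_iff₀ (by positivity), mul_comm]
    calc _ ≤ (Real.Gamma (M + 2 - q) * (M + 2) ^ q) * (M + 1 + c) ^ q :=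
          mul_le_mul (h1.trans (by gcongr)) h4 (by positivity) (by positivity)
      _ = _ := by ring
  have hmono : ∀ M, N ≤ M → D M ≤ D N := by
    intro M hM
    induction M, hM using Nat.le_induction with
    | base => exact le_rfl
    | succ M hM ih => exact (hstep M hM).trans ih
  have hone : 1 ≤ D N := by
    refine le_of_forall_pos_le_add fun ε hε => ?_
    obtain ⟨M, hM⟩ := exists_nat_gt (1 / ε)
    have h1 := (hlow (max M N)).trans (hmono _ (le_max_right M N))
    have h2 : (M : ℝ) ≤ (max M N : ℕ) := by exact_mod_cast le_max_left M N
    generalize ((max M N : ℕ) : ℝ) = y at h1 h2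
    have h0 : 0 < 1 / ε := by positivity
    have h3 : 1 ≤ ε * y := by
      have : 1 / ε ≤ y := by linarith
      rwa [div_le_iff₀ hε, mul_comm] at this
    have h4 : 1 - ε ≤ (y + 1) / (y + 2) := by
      rw [le_div_iff₀ (by linarith)]
      nlinarith
    linarith
  simp only [hD] at hone
  rw [Real.rpow_neg (by positivity), ← div_eq_mul_inv, div_le_iff₀ (by positivity)]
  rwa [div_mul_eq_mul_div, le_div_iff₀ (by positivity), one_mul] at hone

lemma one_sub_mul_exp_le_one {x : ℝ} (h0 : 0 ≤ x) (h1 : x < 1) :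
    (1 - x) * exp (x + x ^ 2 / 2) ≤ 1 := by
  have h := hasSum_pow_div_log_of_abs_lt_one (x := x) (by rwa [abs_of_nonneg h0])
  have h2 := sum_le_hasSum (Finset.range 2) (fun i _ => by positivity) h
  simp only [Finset.sum_range_succ, Finset.sum_range_zero] at h2
  norm_num at h2
  rw [← Real.exp_log (show 0 < 1 - x by linarith), ← exp_add]
  exact Real.exp_le_one_iff.2 (by linarith)

lemma Gamma_nat_add_two_sub (q : ℝ) (hq : q ≤ 1) (n : ℕ) :
    Real.Gamma (n + 2 - q) = (∏ k ∈ Finset.range n, ((k : ℝ) + 2 - q)) * Real.Gamma (2 - q) := by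
  induction n with
  | zero => simp
  | succ n ih =>
    have hn : (0:ℝ) ≤ n := Nat.cast_nonneg n
    rw [Finset.prod_range_succ, mul_right_comm, ← ih, mul_comm, ← Real.Gamma_add_one (by linarith)]
    congr 1; push_cast; ring

lemma log_265_div_23_le : log (265 / 23) ≤ 2.444575 := by
  have h2 : log ((265 / 184) ^ 2) = log 2 + log (70225 / 67712) := by
    rw [← log_mul (by norm_num) (by norm_num)]; norm_num
  have h3 : log (265 / 23) = 3 * log 2 + log (265 / 184) := by
    rw [show (3:ℝ) * log 2 = ((3 : ℕ) : ℝ) * log 2 by norm_num, ← log_pow,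
      ← log_mul (by norm_num) (by norm_num)]; norm_num
  rw [log_pow] at h2
  have h4 := log_le_sub_one_of_pos (show (0:ℝ) < 70225 / 67712 by norm_num)
  have h5 := log_two_lt_d9
  push_cast at h2
  norm_num at h4 h5 ⊢
  linarith

lemma log_three_halves_ge : 0.40545 ≤ log (3 / 2) := by
  have h1 : log ((3 / 2) ^ 12) = log (2 ^ 7) + log (531441 / 524288) := by
    rw [← log_mul (by norm_num) (by norm_num)]; norm_num
  rw [log_pow, log_pow] at h1
  have h4 := one_sub_inv_le_log_of_pos (show (0:ℝ) < 531441 / 524288 by norm_num)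
  have h5 := log_two_gt_d9
  push_cast at h1
  norm_num at h4 h5 ⊢
  linarith

lemma exp_le_Gamma_two_sub {q : ℝ} (hq0 : 0 < q) (hq1 : q ≤ 1) :
    exp (-0.4247 * q + 0.3242 * q ^ 2) ≤ Real.Gamma (2 - q) := by
  have h := factorial_mul_rpow_le_Gamma hq0 hq1 10
  rw [Gamma_nat_add_two_sub q hq1 10] at h
  set P := ∏ k ∈ Finset.range 10, ((k : ℝ) + 2 - q) with hP
  have hP0 : 0 < P := Finset.prod_pos fun k _ => by
    have : (0:ℝ) ≤ k := Nat.cast_nonneg k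
    linarith
  have h1 : P * exp (q * ∑ k ∈ Finset.range 10, (1 / ((k : ℝ) + 2)) +
      q ^ 2 / 2 * ∑ k ∈ Finset.range 10, (1 / ((k : ℝ) + 2)) ^ 2) ≤
      ((10 + 1 : ℕ).factorial : ℝ) := by
    have e : ((10 + 1 : ℕ).factorial : ℝ) = ∏ k ∈ Finset.range 10, ((k : ℝ) + 2) := by
      norm_num [Finset.prod_range_succ, Nat.factorial]
    rw [e, Finset.mul_sum, Finset.mul_sum, ← Finset.sum_add_distrib, exp_sum, hP,
      ← Finset.prod_mul_distrib]
    refine Finset.prod_le_prod (fun k _ => ?_) fun k _ => ?_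
    · have : (0:ℝ) ≤ k := Nat.cast_nonneg k
      exact mul_nonneg (by linarith) (exp_pos _).le
    · have hk : (0:ℝ) ≤ k := Nat.cast_nonneg k
      have := one_sub_mul_exp_le_one (x := q / (k + 2)) (by positivity)
        ((div_lt_one (by positivity)).2 (by linarith))
      have h3 := mul_le_mul_of_nonneg_left this (show 0 ≤ (k : ℝ) + 2 by positivity)
      refine le_trans (le_of_eq ?_) (h3.trans_eq (mul_one _))
      rw [← mul_assoc, mul_sub, mul_one, mul_div_cancel₀ _ (by positivity)]
      congr 2
      field_simp
  have h2 : exp (-(q * (2.444575 - 0.0452 * q))) ≤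
      (((10 : ℕ) : ℝ) + 1 + (1 - q) * (1 / 2 + 1 / (4 * ((10 : ℕ) : ℝ) + 6))) ^ (-q) := by
    have e : ((10 : ℕ) : ℝ) + 1 + (1 - q) * (1 / 2 + 1 / (4 * ((10 : ℕ) : ℝ) + 6)) =
        265 / 23 * (1 - 12 / 265 * q) := by push_cast; ring
    have hpos : 0 < 1 - 12 / 265 * q := by linarith
    rw [e, Real.rpow_def_of_pos (by positivity), exp_le_exp, log_mul (by norm_num) hpos.ne']
    have h3 := log_265_div_23_le
    have h4 := log_le_sub_one_of_pos hpos
    have : log (265 / 23) + log (1 - 12 / 265 * q) ≤ 2.444575 - 0.0452 * q := by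
      norm_num at h3 ⊢; linarith
    nlinarith
  have h5 : exp (-0.4247 * q + 0.3242 * q ^ 2) ≤
      exp (q * ∑ k ∈ Finset.range 10, (1 / ((k : ℝ) + 2)) +
      q ^ 2 / 2 * ∑ k ∈ Finset.range 10, (1 / ((k : ℝ) + 2)) ^ 2) *
      exp (-(q * (2.444575 - 0.0452 * q))) := by
    rw [← exp_add, exp_le_exp]
    norm_num [Finset.sum_range_succ]
    nlinarith [sq_nonneg q]
  refine h5.trans ?_
  refine le_of_mul_le_mul_left ?_ hP0
  rw [← mul_assoc]
  exact (mul_le_mul h1 h2 (exp_pos _).le (by positivity)).trans h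

/-- Lower bound for the Gamma factor controlling the endpoint `x = 0`. -/
lemma Gamma_two_sub_mul_ge {q : ℝ} (hq0 : 1 / 8 ≤ q) (hq1 : q ≤ 1) :
    exp (q * (-0.01926 + 0.1598 * q)) ≤ Real.Gamma (2 - q) * (2 - (2 / 3) ^ q) := by
  set u := 0.40545 * q with hu
  have hu0 : 0 ≤ u := by rw [hu]; norm_num; linarith
  have hu1 : u ≤ 0.41 := by rw [hu]; norm_num; linarith
  have h1 : ((2:ℝ) / 3) ^ q ≤ exp (-u) := by
    rw [Real.rpow_def_of_pos (by norm_num), exp_le_exp, show (2:ℝ) / 3 = (3 / 2)⁻¹ by norm_num,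
      log_inv]
    have := log_three_halves_ge
    nlinarith
  have h2 : exp (-u) ≤ 1 - u + u ^ 2 / 2 := by
    have h := Real.quadratic_le_exp_of_nonneg hu0
    rw [exp_neg]
    refine inv_le_of_inv_le₀ (by nlinarith) (le_trans ?_ h)
    rw [inv_le_iff_one_le_mul₀ (by nlinarith)]
    nlinarith [pow_nonneg hu0 4]
  have h3 : exp (u - u ^ 2) ≤ 1 + u - u ^ 2 / 2 := by
    have hv : 0 ≤ u - u ^ 2 := by nlinarith
    have h := Real.exp_bound' hv (by nlinarith) (n := 3) (by norm_num)
    norm_num [Finset.sum_range_succ, Nat.factorial] at h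
    have hv3 : (u - u ^ 2) ^ 3 ≤ u ^ 3 := pow_le_pow_left₀ hv (by nlinarith) 3
    nlinarith [pow_nonneg hu0 3, pow_nonneg hu0 4, mul_nonneg (pow_nonneg hu0 3) (sub_nonneg.2 hu1)]
  have h4 := exp_le_Gamma_two_sub (show 0 < q by linarith) hq1
  have h5 : exp (u - u ^ 2) ≤ 2 - (2 / 3) ^ q := by linarith
  refine le_trans ?_ (mul_le_mul h4 h5 (exp_pos _).le ((exp_pos _).le.trans h4))
  rw [← exp_add, exp_le_exp, hu]
  norm_num
  nlinarith [sq_nonneg q]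

lemma Gamma_two_sub_ge_of_le {q : ℝ} (hq0 : 0 < q) (hq1 : q ≤ 21 / 50) :
    1 - q * (1 - q) / 2 ≤ Real.Gamma (2 - q) := by
  refine le_trans ?_ (exp_le_Gamma_two_sub hq0 (by linarith))
  refine le_trans ?_ (add_one_le_exp _)
  norm_num
  nlinarith

lemma Gamma_two_sub_ge_of_ge {q : ℝ} (hq0 : 21 / 50 ≤ q) (hq1 : q ≤ 1) :
    1 - q * (1 - q) / 2 - q ^ 2 * (1 - q ^ 2) / 16 ≤ Real.Gamma (2 - q) := by
  have h := factorial_mul_rpow_le_Gamma (show 0 < q by linarith) hq1 1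
  rw [Gamma_nat_add_two_sub q hq1 1] at h
  obtain ⟨e, he⟩ : ∃ e, e = 1 - q := ⟨_, rfl⟩
  obtain rfl : q = 1 - e := by linarith
  have he0 : 0 ≤ e := by linarith
  have he1 : e ≤ 29 / 50 := by linarith
  have h0 : 0 < 2 * (1 + 3 / 10 * e) := by linarith
  norm_num [Nat.factorial] at h
  rw [show (2:ℝ) + e * (3 / 5) = 2 * (1 + 3 / 10 * e) by ring, Real.rpow_sub_one h0.ne',
    show (2:ℝ) - (1 - e) = 1 + e by ring] at h
  have hy : 1 + e * (0.693 + 0.3 * e - 0.045 * e ^ 2) +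
      (e * (0.693 + 0.3 * e - 0.045 * e ^ 2)) ^ 2 / 2 ≤ (2 * (1 + 3 / 10 * e)) ^ e := by
    have h1 : 0.3 * e - 0.045 * e ^ 2 ≤ log (1 + 3 / 10 * e) := by
      refine le_trans ?_ (le_log_one_add_of_nonneg (by positivity))
      rw [le_div_iff₀ (by positivity)]
      norm_num
      nlinarith [pow_nonneg he0 3]
    have h2 := log_two_gt_d9
    have h3 : 0 ≤ 0.693 + 0.3 * e - 0.045 * e ^ 2 := by norm_num; nlinarith
    refine (Real.quadratic_le_exp_of_nonneg (by positivity)).trans ?_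
    rw [Real.rpow_def_of_pos h0, exp_le_exp, log_mul (by norm_num) (by positivity), mul_comm]
    refine mul_le_mul_of_nonneg_right ?_ he0
    norm_num at h1 h2 ⊢
    linarith
  have h4 : (1 + e) * (1 + 3 / 10 * e) *
      (1 - (1 - e) * (1 - (1 - e)) / 2 - (1 - e) ^ 2 * (1 - (1 - e) ^ 2) / 16) ≤
      1 + e * (0.693 + 0.3 * e - 0.045 * e ^ 2) +
      (e * (0.693 + 0.3 * e - 0.045 * e ^ 2)) ^ 2 / 2 := by
    have h1 : 0 ≤ 0.018 + 0.24 * e - 0.456 * e ^ 2 := by norm_num; nlinarith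
    have h2 : 0 ≤ 0.032 - 0.02 * e - 0.018 * e ^ 2 := by norm_num; nlinarith
    have h3 := mul_nonneg he0 h1
    have h4 := mul_nonneg (pow_nonneg he0 4) h2
    norm_num at h3 h4 ⊢
    nlinarith [pow_nonneg he0 2, pow_nonneg he0 3, pow_nonneg he0 4, pow_nonneg he0 5,
      pow_nonneg he0 6]
  have h5 := h4.trans hy
  have h6 : 2 * ((2 * (1 + 3 / 10 * e)) ^ e / (2 * (1 + 3 / 10 * e))) * (1 + 3 / 10 * e) =
      (2 * (1 + 3 / 10 * e)) ^ e := by field_simp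
  have h7 := mul_le_mul_of_nonneg_right h (show 0 ≤ 1 + 3 / 10 * e by positivity)
  rw [h6] at h7
  refine le_of_mul_le_mul_left (a := (1 + e) * (1 + 3 / 10 * e)) ?_ (by positivity)
  rw [show (2:ℝ) - (1 - e) = 1 + e by ring]
  linarith

lemma rpow_neg_add_le {q x y a b : ℝ} (hq : 0 ≤ q) (hx : 0 < x) (hy : 0 < y) (ha : 0 ≤ a)
    (hb : 0 ≤ b) (hab : a + b = 1) :
    (a * x + b * y) ^ (-q) ≤ a * x ^ (-q) + b * y ^ (-q) := by
  have h1 := Real.geom_mean_le_arith_mean2_weighted ha hb hx.le hy.le hab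
  have h2 := Real.geom_mean_le_arith_mean2_weighted ha hb (Real.rpow_nonneg hx.le (-q))
    (Real.rpow_nonneg hy.le (-q)) hab
  refine le_trans ?_ h2
  have h3 := Real.rpow_le_rpow_of_nonpos (mul_pos (Real.rpow_pos_of_pos hx a)
    (Real.rpow_pos_of_pos hy b)) h1 (neg_nonpos.2 hq)
  rw [Real.mul_rpow (by positivity) (by positivity), ← Real.rpow_mul hx.le,
    ← Real.rpow_mul hy.le] at h3
  rw [← Real.rpow_mul hx.le, ← Real.rpow_mul hy.le, mul_comm (-q), mul_comm (-q)]
  exact h3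

lemma two_mul_rpow_neg_le {q x y : ℝ} (hq : 0 ≤ q) (hx : 0 < x) (hy : 0 < y) :
    2 * ((x + y) / 2) ^ (-q) ≤ x ^ (-q) + y ^ (-q) := by
  have h := rpow_neg_add_le hq hx hy (a := 1 / 2) (b := 1 / 2) (by norm_num) (by norm_num)
    (by norm_num)
  rw [show 1 / 2 * x + 1 / 2 * y = (x + y) / 2 by ring] at h
  linarith

lemma Phi_of_one_le {q x : ℝ} (hx : 1 ≤ x) : Phi (2 * q) x = (1 + x) ^ (-q) := by
  rw [Phi, if_pos hx]; congr 1; ring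

lemma Phi_of_le_one {q x : ℝ} (hx : x ≤ 1) :
    Phi (2 * q) x = 2 * 2 ^ (-q) - (3 - x) ^ (-q) := by
  have e : -(2 * q) / 2 = -q := by ring
  rcases hx.eq_or_lt with rfl | hx
  · rw [Phi, if_pos le_rfl, e]; norm_num; ring
  · rw [Phi, if_neg (not_le.2 hx), e]

lemma measurable_Phi (p : ℝ) : Measurable (Phi p) :=
  Measurable.ite measurableSet_Ici (by fun_prop) (by fun_prop)

lemma Phi_nonneg {q x : ℝ} (hq : 0 ≤ q) : 0 ≤ Phi (2 * q) x := by
  rcases le_total 1 x with hx | hx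
  · rw [Phi_of_one_le hx]; positivity
  · rw [Phi_of_le_one hx]
    have h := Real.rpow_le_rpow_of_nonpos two_pos (show 2 ≤ 3 - x by linarith) (neg_nonpos.2 hq)
    have : (0:ℝ) < 2 ^ (-q) := by positivity
    linarith

lemma Phi_le {q x : ℝ} (hq : 0 ≤ q) (hx : 0 ≤ x) : Phi (2 * q) x ≤ (1 + x) ^ (-q) := by
  rcases le_total 1 x with hx1 | hx1
  · rw [Phi_of_one_le hx1]
  · rw [Phi_of_le_one hx1]
    have h := two_mul_rpow_neg_le hq (show 0 < 1 + x by linarith) (show 0 < 3 - x by linarith)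
    rw [show (1 + x + (3 - x)) / 2 = 2 by ring] at h
    linarith

lemma Phi_add_Phi_le {q x t : ℝ} (hq : 0 ≤ q) (hx : x < 1) (ht : 0 ≤ t) (htx : t ≤ x) :
    Phi (2 * q) (x + t) + Phi (2 * q) (x - t) ≤ 2 * Phi (2 * q) x := by
  rw [Phi_of_le_one (show x - t ≤ 1 by linarith), Phi_of_le_one hx.le]
  rcases le_total (x + t) 1 with h1 | h1
  · rw [Phi_of_le_one h1]
    have h := two_mul_rpow_neg_le hq (show 0 < 3 - (x + t) by linarith)
      (show 0 < 3 - (x - t) by linarith)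
    rw [show (3 - (x + t) + (3 - (x - t))) / 2 = 3 - x by ring] at h
    linarith
  · rw [Phi_of_one_le h1]
    obtain ⟨D, hD⟩ : ∃ D, D = 3 - (x - t) := ⟨_, rfl⟩
    have hD2 : 0 < D - 2 := by linarith
    have hchord : ∀ z, 2 ≤ z → z ≤ D →
        (D - 2) * z ^ (-q) ≤ (D - z) * 2 ^ (-q) + (z - 2) * D ^ (-q) := by
      intro z hz2 hzD
      have h := rpow_neg_add_le hq two_pos (show 0 < D by linarith)
        (a := (D - z) / (D - 2)) (b := (z - 2) / (D - 2)) (div_nonneg (by linarith) hD2.le)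
        (div_nonneg (by linarith) hD2.le) (by field_simp; ring)
      rw [show (D - z) / (D - 2) * 2 + (z - 2) / (D - 2) * D = z by field_simp; ring] at h
      have h' := mul_le_mul_of_nonneg_left h hD2.le
      refine h'.trans_eq ?_
      field_simp
    have hA := hchord (1 + (x + t)) (by linarith) (by linarith)
    have hB := hchord (3 - x) (by linarith) (by linarith)
    rw [← hD]
    refine le_of_mul_le_mul_left ?_ hD2
    have e : (D - (1 + (x + t))) + 2 * (D - (3 - x)) = 2 * (D - 2) := by rw [hD]; ring
    have e2 : (1 + (x + t) - 2) + 2 * (3 - x - 2) = D - 2 := by rw [hD]; ring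
    have e3 := congrArg (· * (2:ℝ) ^ (-q)) e
    have e4 := congrArg (· * D ^ (-q)) e2
    linarith

/-- The quartic Taylor bound for the two-term case lies below the target profile. -/
lemma quartic_le_Gamma_mul_Phi {q x : ℝ} (hq0 : 1 / 8 ≤ q) (hq1 : q ≤ 1) (hx0 : 0 ≤ x)
    (hx1 : x ≤ 1) :
    1 - q * (1 - q) / 2 * x - q ^ 2 * (1 - q ^ 2) / 12 * x ^ 2 ≤
      2 ^ q * Real.Gamma (2 - q) * Phi (2 * q) x := by
  have hG : 0 < Real.Gamma (2 - q) := Real.Gamma_pos_of_pos (by linarith)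
  have h2 : (2:ℝ) ^ q * 2 ^ (-q) = 1 := by rw [← Real.rpow_add two_pos]; simp
  have h3 : (2:ℝ) ^ q * 3 ^ (-q) = (2 / 3) ^ q := by
    rw [Real.div_rpow (by norm_num) (by norm_num), Real.rpow_neg (by norm_num), div_eq_mul_inv]
  have hc := rpow_neg_add_le (show 0 ≤ q by linarith) three_pos (two_pos (α := ℝ))
    (a := 1 - x) (b := x) (by linarith) hx0 (by ring)
  rw [show (1 - x) * 3 + x * 2 = 3 - x by ring] at hc
  have hc2 := mul_le_mul_of_nonneg_left hc (show (0:ℝ) ≤ 2 ^ q by positivity)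
  have hlow : (1 - x) * (Real.Gamma (2 - q) * (2 - (2 / 3) ^ q)) + x * Real.Gamma (2 - q) ≤
      2 ^ q * Real.Gamma (2 - q) * Phi (2 * q) x := by
    rw [Phi_of_le_one hx1]
    have e : (2:ℝ) ^ q * Real.Gamma (2 - q) * (2 * 2 ^ (-q) - (3 - x) ^ (-q)) =
        Real.Gamma (2 - q) * (2 * (2 ^ q * 2 ^ (-q)) - 2 ^ q * (3 - x) ^ (-q)) := by ring
    have e2 : (2:ℝ) ^ q * ((1 - x) * 3 ^ (-q) + x * 2 ^ (-q)) =
        (1 - x) * (2 ^ q * 3 ^ (-q)) + x * (2 ^ q * 2 ^ (-q)) := by ring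
    rw [e2, h3, h2] at hc2
    rw [e, h2]
    nlinarith
  refine le_trans ?_ hlow
  have hi := Gamma_two_sub_mul_ge hq0 hq1
  have hi' := (add_one_le_exp _).trans hi
  have hc1 : 0 ≤ q * (1 - q) := mul_nonneg (by linarith) (by linarith)
  have hc2' : 0 ≤ q ^ 2 * (1 - q ^ 2) := mul_nonneg (by positivity) (by nlinarith)
  rcases le_total q (21 / 50) with h | h
  · have hii := Gamma_two_sub_ge_of_le (show 0 < q by linarith) h
    have hf : 0 ≤ q * (-0.01926 + 0.1598 * q) :=
      mul_nonneg (by linarith) (by norm_num; linarith)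
    have hA : 1 ≤ Real.Gamma (2 - q) * (2 - (2 / 3) ^ q) := by linarith
    have m1 := mul_le_mul_of_nonneg_left hA (show 0 ≤ 1 - x by linarith)
    have m2 := mul_le_mul_of_nonneg_left hii hx0
    have m3 := mul_nonneg hc2' (sq_nonneg x)
    linarith
  · have hii := Gamma_two_sub_ge_of_ge h hq1
    have hf : q ^ 2 * (1 - q ^ 2) / 48 ≤ q * (-0.01926 + 0.1598 * q) := by
      have : q * (1 - q ^ 2) / 48 ≤ -0.01926 + 0.1598 * q := by
        norm_num
        nlinarith [pow_nonneg (show 0 ≤ q by linarith) 3]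
      have := mul_le_mul_of_nonneg_left this (show 0 ≤ q by linarith)
      refine le_trans (le_of_eq ?_) this
      ring
    have hA : 1 + q ^ 2 * (1 - q ^ 2) / 48 ≤ Real.Gamma (2 - q) * (2 - (2 / 3) ^ q) := by linarith
    have m1 := mul_le_mul_of_nonneg_left hA (show 0 ≤ 1 - x by linarith)
    have m2 := mul_le_mul_of_nonneg_left hii hx0
    have m3 := mul_nonneg hc2' (sq_nonneg (x - 1 / 2))
    nlinarith

/-- Comparison for the four-dimensional radial Laplacian `m'' + 3 m' / r = g`. -/
lemma le_of_radial_laplacian_ge {m m₁ g : ℝ → ℝ} {A B : ℝ}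
    (hm : ∀ r ∈ Ico (0:ℝ) 1, HasDerivAt m (m₁ r) r)
    (hm₁ : ∀ r ∈ Ioo (0:ℝ) 1, HasDerivAt m₁ (g r - 3 * m₁ r / r) r)
    (hc : ContinuousOn m₁ (Ico 0 1)) (hg : ∀ r ∈ Ioo (0:ℝ) 1, A + B * r ^ 2 ≤ g r)
    {r : ℝ} (hr : r ∈ Ico (0:ℝ) 1) : m 0 + A * r ^ 2 / 8 + B * r ^ 4 / 24 ≤ m r := by
  have h1 : ∀ s ∈ Ioo (0:ℝ) 1, A * s / 4 + B * s ^ 3 / 6 ≤ m₁ s := by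
    intro s hs
    have hs0 := hs.1
    have h := le_of_hasDerivAt_nonneg (f := fun t => t ^ 3 * m₁ t - A * t ^ 4 / 4 - B * t ^ 6 / 6)
      (f' := fun t => t ^ 3 * (g t - (A + B * t ^ 2))) hs.1.le
      (by
        have hc' : ContinuousOn m₁ (Icc 0 s) := hc.mono fun t ht => ⟨ht.1, ht.2.trans_lt hs.2⟩
        fun_prop)
      (fun t ht => by
        have ht0 : t ≠ 0 := ht.1.ne'
        refine (((((hasDerivAt_pow 3 t).mul (hm₁ t ⟨ht.1, ht.2.trans hs.2⟩)).sub
          (((hasDerivAt_pow 4 t).const_mul A).div_const 4))).sub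
          (((hasDerivAt_pow 6 t).const_mul B).div_const 6)).congr_deriv ?_
        field_simp
        norm_num
        ring)
      (fun t ht => mul_nonneg (pow_nonneg ht.1.le 3)
        (sub_nonneg.2 (hg t ⟨ht.1, ht.2.trans hs.2⟩)))
    have e : s ^ 3 * (A * s / 4 + B * s ^ 3 / 6) ≤ s ^ 3 * m₁ s := by
      norm_num at h
      linarith
    exact le_of_mul_le_mul_left e (by positivity)
  have h := le_of_hasDerivAt_nonneg (f := fun t => m t - A * t ^ 2 / 8 - B * t ^ 4 / 24)
    (f' := fun t => m₁ t - (A * t / 4 + B * t ^ 3 / 6)) hr.1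
    (fun t ht => by
      have := (hm t ⟨ht.1, ht.2.trans_lt hr.2⟩).continuousAt.continuousWithinAt (s := Icc 0 r)
      fun_prop)
    (fun t ht => by
      refine (((hm t ⟨ht.1.le, ht.2.trans hr.2⟩).sub
        (((hasDerivAt_pow 2 t).const_mul A).div_const 8)).sub
        (((hasDerivAt_pow 4 t).const_mul B).div_const 24)).congr_deriv ?_
      norm_num
      ring)
    (fun t ht => sub_nonneg.2 (h1 t ⟨ht.1, ht.2.trans hr.2⟩))
  norm_num at h
  linarith

lemma one_add_two_mul_add_sq_pos {r u : ℝ} (hr : r ∈ Ioo (-1 : ℝ) 1) (hu : |u| ≤ 1) :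
    0 < 1 + 2 * r * u + r ^ 2 := by
  obtain ⟨h1, h2⟩ := abs_le.1 hu
  nlinarith [hr.1, hr.2, sq_nonneg (r + u), sq_nonneg (r - u), mul_pos (sub_pos.2 hr.2)
    (show 0 < 1 + r by linarith [hr.1])]

namespace IsUniformOnSphere

variable {μ : Measure (EuclideanSpace ℝ (Fin 4))}

lemma integrable_coord (hμ : IsUniformOnSphere μ) [IsProbabilityMeasure μ] {g : ℝ → ℝ}
    (hg : Measurable g) (hc : ContinuousOn g (Icc (-1) 1)) : Integrable (fun x => g (x 0)) μ := by
  obtain ⟨M, hM⟩ := isCompact_Icc.exists_bound_of_continuousOn hc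
  refine Integrable.of_bound (Measurable.aestronglyMeasurable (by fun_prop)) M ?_
  filter_upwards [hμ.ae_abs_le] with x hx
  exact hM _ (abs_le.1 hx)

lemma hasDerivAt_integral_coord (hμ : IsUniformOnSphere μ) [IsProbabilityMeasure μ]
    {F F' : ℝ → ℝ → ℝ}
    (hF : ContinuousOn (Function.uncurry F) (Ioo (-1) 1 ×ˢ Icc (-1) 1))
    (hF' : ContinuousOn (Function.uncurry F') (Ioo (-1) 1 ×ˢ Icc (-1) 1))
    (hm : ∀ r, Measurable (F r)) (hm' : ∀ r, Measurable (F' r))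
    (hd : ∀ r ∈ Ioo (-1 : ℝ) 1, ∀ u, |u| ≤ 1 → HasDerivAt (fun r => F r u) (F' r u) r)
    {r : ℝ} (hr : r ∈ Ioo (-1 : ℝ) 1) :
    HasDerivAt (fun r => ∫ x, F r (x 0) ∂μ) (∫ x, F' r (x 0) ∂μ) r := by
  obtain ⟨a, ha, har⟩ := exists_between hr.1
  obtain ⟨b, hrb, hb⟩ := exists_between hr.2
  obtain ⟨M, hM⟩ := (isCompact_Icc.prod
    (isCompact_Icc (a := (-1 : ℝ)) (b := 1))).exists_bound_of_continuousOn
    (hF'.mono (prod_mono (s₁ := Icc a b) (fun t ht => ⟨ha.trans_le ht.1, ht.2.trans_lt hb⟩)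
      subset_rfl))
  have hsec : ∀ u, |u| ≤ 1 → u ∈ Icc (-1 : ℝ) 1 := fun u hu => abs_le.1 hu
  refine (hasDerivAt_integral_of_dominated_loc_of_deriv_le
    (F := fun r (x : EuclideanSpace ℝ (Fin 4)) => F r (x 0))
    (F' := fun r (x : EuclideanSpace ℝ (Fin 4)) => F' r (x 0)) (bound := fun _ => M)
    (Icc_mem_nhds har hrb)
    (Filter.Eventually.of_forall fun t => Measurable.aestronglyMeasurable ?_) ?_
    (Measurable.aestronglyMeasurable ?_) ?_ (integrable_const M) ?_).2
  · have := hm t; fun_prop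
  · refine hμ.integrable_coord (hm r) ?_
    exact hF.comp (f := fun u => (r, u)) (by fun_prop) fun u hu => ⟨hr, hu⟩
  · have := hm' r; fun_prop
  · filter_upwards [hμ.ae_abs_le] with x hx t ht
    exact hM (t, x 0) ⟨ht, hsec _ hx⟩
  · filter_upwards [hμ.ae_abs_le] with x hx t ht
    exact hd t ⟨ha.trans_le ht.1, ht.2.trans_lt hb⟩ _ hx

end IsUniformOnSphere

/-- The moment `E |e + r ξ|^{-2 k}`, `e` a unit vector. -/
noncomputable def radialMoment (μ : Measure (EuclideanSpace ℝ (Fin 4))) (k r : ℝ) : ℝ :=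
  ∫ x, (1 + 2 * r * x 0 + r ^ 2) ^ (-k) ∂μ

/-- The derivative of `radialMoment` in `r`. -/
noncomputable def radialMomentDeriv (μ : Measure (EuclideanSpace ℝ (Fin 4))) (k r : ℝ) : ℝ :=
  ∫ x, -k * ((2 * x 0 + 2 * r) * (1 + 2 * r * x 0 + r ^ 2) ^ (-k - 1)) ∂μ

lemma continuousOn_one_add_two_mul_rpow (k : ℝ) :
    ContinuousOn (fun p : ℝ × ℝ => (1 + 2 * p.1 * p.2 + p.1 ^ 2) ^ k)
      (Ioo (-1) 1 ×ˢ Icc (-1) 1) :=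
  ContinuousOn.rpow_const (by fun_prop) fun _ hp =>
    Or.inl (one_add_two_mul_add_sq_pos hp.1 (abs_le.2 hp.2)).ne'

lemma continuousOn_one_add_two_mul_rpow_right {r : ℝ} (hr : r ∈ Ioo (-1 : ℝ) 1) (k : ℝ) :
    ContinuousOn (fun u : ℝ => (1 + 2 * r * u + r ^ 2) ^ k) (Icc (-1) 1) :=
  (continuousOn_one_add_two_mul_rpow k).comp (f := fun u => (r, u)) (by fun_prop)
    fun _ hu => ⟨hr, hu⟩

namespace IsUniformOnSphere

variable {μ : Measure (EuclideanSpace ℝ (Fin 4))}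

lemma hasDerivAt_radialMoment (hμ : IsUniformOnSphere μ) [IsProbabilityMeasure μ] (k : ℝ) {r : ℝ}
    (hr : r ∈ Ioo (-1 : ℝ) 1) :
    HasDerivAt (radialMoment μ k) (radialMomentDeriv μ k r) r := by
  refine hμ.hasDerivAt_integral_coord (F := fun r u => (1 + 2 * r * u + r ^ 2) ^ (-k))
    (F' := fun r u => -k * ((2 * u + 2 * r) * (1 + 2 * r * u + r ^ 2) ^ (-k - 1)))
    ?_ ?_ (fun r => by fun_prop) (fun r => by fun_prop) ?_ hr
  · exact continuousOn_one_add_two_mul_rpow _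
  · have := continuousOn_one_add_two_mul_rpow (-k - 1)
    simp only [Function.uncurry_def]
    fun_prop
  · intro t ht u hu
    have h1 : HasDerivAt (fun t => 1 + 2 * t * u + t ^ 2) (2 * u + 2 * t) t := by
      refine (((((hasDerivAt_id t).const_mul 2).mul_const u).const_add 1).add
        (hasDerivAt_pow 2 t)).congr_deriv ?_
      norm_num
    refine (h1.rpow_const (Or.inl (one_add_two_mul_add_sq_pos ht hu).ne')).congr_deriv ?_
    ring

lemma hasDerivAt_radialMomentDeriv (hμ : IsUniformOnSphere μ) [IsProbabilityMeasure μ] (k : ℝ)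
    {r : ℝ} (hr : r ∈ Ioo (-1 : ℝ) 1) :
    HasDerivAt (radialMomentDeriv μ k)
      (∫ x, -k * (2 * (1 + 2 * r * x 0 + r ^ 2) ^ (-k - 1) +
        (2 * x 0 + 2 * r) ^ 2 * ((-k - 1) * (1 + 2 * r * x 0 + r ^ 2) ^ (-k - 2))) ∂μ) r := by
  refine hμ.hasDerivAt_integral_coord
    (F := fun r u => -k * ((2 * u + 2 * r) * (1 + 2 * r * u + r ^ 2) ^ (-k - 1)))
    (F' := fun r u => -k * (2 * (1 + 2 * r * u + r ^ 2) ^ (-k - 1) +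
      (2 * u + 2 * r) ^ 2 * ((-k - 1) * (1 + 2 * r * u + r ^ 2) ^ (-k - 2))))
    ?_ ?_ (fun r => by fun_prop) (fun r => by fun_prop) ?_ hr
  · have := continuousOn_one_add_two_mul_rpow (-k - 1)
    simp only [Function.uncurry_def]
    fun_prop
  · have := continuousOn_one_add_two_mul_rpow (-k - 1)
    have := continuousOn_one_add_two_mul_rpow (-k - 2)
    simp only [Function.uncurry_def]
    fun_prop
  · intro t ht u hu
    have h1 : HasDerivAt (fun t => 1 + 2 * t * u + t ^ 2) (2 * u + 2 * t) t := by
      refine (((((hasDerivAt_id t).const_mul 2).mul_const u).const_add 1).add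
        (hasDerivAt_pow 2 t)).congr_deriv ?_
      norm_num
    have h2 : HasDerivAt (fun t => 2 * u + 2 * t) 2 t :=
      (((hasDerivAt_id t).const_mul 2).const_add (2 * u)).congr_deriv (by norm_num)
    refine ((h2.mul (h1.rpow_const (p := -k - 1)
      (Or.inl (one_add_two_mul_add_sq_pos ht hu).ne'))).const_mul (-k)).congr_deriv ?_
    rw [show -k - 1 - 1 = -k - 2 by ring]
    ring

/-- `|e + r ξ|^{-2 k}` has four-dimensional Laplacian `4 k (k - 1) |e + r ξ|^{-2(k+1)}`. -/
lemma hasDerivAt_radialMomentDeriv' (hμ : IsUniformOnSphere μ) [IsProbabilityMeasure μ] (k : ℝ)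
    {r : ℝ} (hr : r ∈ Ioo (0 : ℝ) 1) :
    HasDerivAt (radialMomentDeriv μ k)
      (4 * k * (k - 1) * radialMoment μ (k + 1) r - 3 * radialMomentDeriv μ k r / r) r := by
  have hr' : r ∈ Ioo (-1 : ℝ) 1 := ⟨by linarith [hr.1], hr.2⟩
  refine (hμ.hasDerivAt_radialMomentDeriv k hr').congr_deriv ?_
  have hc1 := continuousOn_one_add_two_mul_rpow_right hr' (-k - 1)
  have hc2 := continuousOn_one_add_two_mul_rpow_right hr' (-k - 2)
  set I := ∫ x, (1 + 2 * r * x 0 + r ^ 2) ^ (-k - 1) ∂μ with hI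
  set J := ∫ x, x 0 * (1 + 2 * r * x 0 + r ^ 2) ^ (-k - 1) ∂μ with hJ
  set T := ∫ x, (1 + 2 * r * x 0 + r ^ 2) ^ (-k - 2) * (1 - x 0 ^ 2) ∂μ with hT
  have hiI : Integrable (fun x => (1 + 2 * r * x 0 + r ^ 2) ^ (-k - 1)) μ :=
    hμ.integrable_coord (g := fun u => (1 + 2 * r * u + r ^ 2) ^ (-k - 1)) (by fun_prop) hc1
  have hiJ : Integrable (fun x => x 0 * (1 + 2 * r * x 0 + r ^ 2) ^ (-k - 1)) μ :=
    hμ.integrable_coord (g := fun u => u * (1 + 2 * r * u + r ^ 2) ^ (-k - 1)) (by fun_prop)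
      (by fun_prop)
  have hiT : Integrable (fun x => (1 + 2 * r * x 0 + r ^ 2) ^ (-k - 2) * (1 - x 0 ^ 2)) μ :=
    hμ.integrable_coord (g := fun u => (1 + 2 * r * u + r ^ 2) ^ (-k - 2) * (1 - u ^ 2))
      (by fun_prop) (by fun_prop)
  have hM : radialMoment μ (k + 1) r = I := by
    rw [radialMoment, hI, show -(k + 1) = -k - 1 by ring]
  have hM' : radialMomentDeriv μ k r = -2 * k * J - 2 * k * r * I := by
    rw [radialMomentDeriv, hI, hJ, ← integral_const_mul, ← integral_const_mul, ← integral_sub]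
    · exact integral_congr_ae (ae_of_all _ fun x => by ring)
    · exact hiJ.const_mul _
    · exact hiI.const_mul _
  have hM2 : ∫ x, -k * (2 * (1 + 2 * r * x 0 + r ^ 2) ^ (-k - 1) +
        (2 * x 0 + 2 * r) ^ 2 * ((-k - 1) * (1 + 2 * r * x 0 + r ^ 2) ^ (-k - 2))) ∂μ =
      (-2 * k + 4 * k * (k + 1)) * I - 4 * k * (k + 1) * T := by
    rw [hI, hT, ← integral_const_mul, ← integral_const_mul, ← integral_sub]
    · refine integral_congr_ae ?_
      filter_upwards [hμ.ae_abs_le] with x hx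
      have hp := one_add_two_mul_add_sq_pos hr' hx
      have e : (1 + 2 * r * x 0 + r ^ 2) ^ (-k - 1) =
          (1 + 2 * r * x 0 + r ^ 2) ^ (-k - 2) * (1 + 2 * r * x 0 + r ^ 2) := by
        rw [← Real.rpow_add_one hp.ne']; congr 1; ring
      rw [e]
      ring
    · exact hiI.const_mul _
    · exact hiT.const_mul _
  have hS : (-k - 1) * (2 * r) * T = 3 * J := by
    obtain ⟨M, hM⟩ := isCompact_Icc.exists_bound_of_continuousOn hc1
    obtain ⟨M', hM'⟩ := isCompact_Icc.exists_bound_of_continuousOn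
      (show ContinuousOn (fun u : ℝ => 2 * r * (-k - 1) * (1 + 2 * r * u + r ^ 2) ^ (-k - 2))
        (Icc (-1) 1) by fun_prop)
    have h := hμ.integral_deriv_mul (f := fun u => (1 + 2 * r * u + r ^ 2) ^ (-k - 1))
      (f' := fun u => 2 * r * (-k - 1) * (1 + 2 * r * u + r ^ 2) ^ (-k - 2)) (by fun_prop)
      (by fun_prop) (M := M) (M' := M') (fun u hu => hM u (abs_le.1 hu))
      (fun u hu => hM' u (abs_le.1 hu)) (fun u hu => by
        have h1 : HasDerivAt (fun u => 1 + 2 * r * u + r ^ 2) (2 * r) u :=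
          ((((hasDerivAt_id u).const_mul (2 * r)).const_add 1).add_const (r ^ 2)).congr_deriv
            (by norm_num)
        refine (h1.rpow_const (Or.inl (one_add_two_mul_add_sq_pos hr' hu).ne')).congr_deriv ?_
        rw [show -k - 1 - 1 = -k - 2 by ring])
    rw [hJ, ← h, hT, ← integral_const_mul]
    exact integral_congr_ae (ae_of_all _ fun x => by ring)
  rw [hM, hM', hM2]
  have hr0 : r ≠ 0 := hr.1.ne'
  field_simp
  linear_combination (2 * k) * hS

lemma radialMoment_zero [IsProbabilityMeasure μ] (k : ℝ) : radialMoment μ k 0 = 1 := by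
  simp [radialMoment]

lemma radialMoment_nonneg (hμ : IsUniformOnSphere μ) (k : ℝ) {r : ℝ}
    (hr : r ∈ Ico (0 : ℝ) 1) : 0 ≤ radialMoment μ k r := by
  refine integral_nonneg_of_ae ?_
  filter_upwards [hμ.ae_abs_le] with x hx
  exact Real.rpow_nonneg (one_add_two_mul_add_sq_pos ⟨by linarith [hr.1], hr.2⟩ hx).le _

lemma continuousOn_radialMomentDeriv (hμ : IsUniformOnSphere μ) [IsProbabilityMeasure μ] (k : ℝ) :
    ContinuousOn (radialMomentDeriv μ k) (Ico 0 1) := fun _ hr =>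
  (hμ.hasDerivAt_radialMomentDeriv k
    ⟨by linarith [hr.1], hr.2⟩).continuousAt.continuousWithinAt

lemma le_radialMoment (hμ : IsUniformOnSphere μ) [IsProbabilityMeasure μ] {k A B : ℝ}
    (h : ∀ r ∈ Ioo (0 : ℝ) 1, A + B * r ^ 2 ≤ 4 * k * (k - 1) * radialMoment μ (k + 1) r)
    {r : ℝ} (hr : r ∈ Ico (0 : ℝ) 1) :
    1 + A * r ^ 2 / 8 + B * r ^ 4 / 24 ≤ radialMoment μ k r := by
  rw [← radialMoment_zero (μ := μ) k]
  exact le_of_radial_laplacian_ge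
    (fun s hs => hμ.hasDerivAt_radialMoment k ⟨by linarith [hs.1], hs.2⟩)
    (fun s hs => hμ.hasDerivAt_radialMomentDeriv' k hs) (hμ.continuousOn_radialMomentDeriv k) h hr

lemma radialMoment_le (hμ : IsUniformOnSphere μ) [IsProbabilityMeasure μ] {q : ℝ} (hq0 : 0 ≤ q)
    (hq1 : q ≤ 1) {r : ℝ} (hr : r ∈ Ico (0 : ℝ) 1) :
    radialMoment μ q r ≤ 1 - q * (1 - q) / 2 * r ^ 2 - q ^ 2 * (1 - q ^ 2) / 12 * r ^ 4 := by
  have h2 : ∀ s ∈ Ico (0 : ℝ) 1, 1 ≤ radialMoment μ (q + 1 + 1) s := by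
    intro s hs
    have := hμ.le_radialMoment (k := q + 1 + 1) (A := 0) (B := 0) (fun t ht => by
      have := hμ.radialMoment_nonneg (q + 1 + 1 + 1) (r := t) ⟨ht.1.le, ht.2⟩
      have : 0 ≤ 4 * (q + 1 + 1) * (q + 1 + 1 - 1) := mul_nonneg (by linarith) (by linarith)
      rw [zero_mul, add_zero]
      positivity) hs
    linarith
  have h1 : ∀ s ∈ Ico (0 : ℝ) 1, 1 + 4 * (q + 1) * q * s ^ 2 / 8 ≤ radialMoment μ (q + 1) s := by
    intro s hs
    have := hμ.le_radialMoment (k := q + 1) (A := 4 * (q + 1) * q) (B := 0) (fun t ht => by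
      have h3 := h2 t ⟨ht.1.le, ht.2⟩
      have : 0 ≤ 4 * (q + 1) * q := by positivity
      rw [add_sub_cancel_right]
      nlinarith) hs
    linarith
  have h0 := le_of_radial_laplacian_ge (m := fun s => -radialMoment μ q s)
    (m₁ := fun s => -radialMomentDeriv μ q s)
    (g := fun s => -(4 * q * (q - 1) * radialMoment μ (q + 1) s))
    (A := 4 * q * (1 - q)) (B := 4 * q * (1 - q) * (4 * (q + 1) * q / 8))
    (fun s hs => (hμ.hasDerivAt_radialMoment q ⟨by linarith [hs.1], hs.2⟩).neg)
    (fun s hs => (hμ.hasDerivAt_radialMomentDeriv' q hs).neg.congr_deriv (by ring))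
    (hμ.continuousOn_radialMomentDeriv q).neg
    (fun s hs => by
      have h3 := h1 s ⟨hs.1.le, hs.2⟩
      have : 0 ≤ 4 * q * (1 - q) := mul_nonneg (by linarith) (by linarith)
      have := mul_le_mul_of_nonneg_left h3 this
      linarith) hr
  rw [radialMoment_zero] at h0
  linarith

lemma norm_add_smul_sq {E : Type*} [NormedAddCommGroup E] [InnerProductSpace ℝ E] {x y : E}
    (hx : ‖x‖ = 1) (hy : ‖y‖ = 1) (r : ℝ) :
    ‖x + r • y‖ ^ 2 = 1 + 2 * r * inner ℝ x y + r ^ 2 := by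
  rw [norm_add_sq_real, inner_smul_right, norm_smul, hx, hy, mul_one, Real.norm_eq_abs, sq_abs]
  ring

/-- The two-term case. -/
lemma lintegral_nnnorm_add_smul_rpow_le (hμ : IsUniformOnSphere μ) [IsProbabilityMeasure μ]
    {q : ℝ} (hq0 : 1 / 8 ≤ q) (hq1 : q ≤ 1) {r : ℝ} (hr : r ∈ Ico (0 : ℝ) 1)
    {x : EuclideanSpace ℝ (Fin 4)} (hx : ‖x‖ = 1) :
    ∫⁻ y, (‖x + r • y‖₊ : ℝ≥0∞) ^ (-(2 * q)) ∂μ ≤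
      ENNReal.ofReal (2 ^ q * Real.Gamma (2 - q) * Phi (2 * q) (r ^ 2)) := by
  have hr' : r ∈ Ioo (-1 : ℝ) 1 := ⟨by linarith [hr.1], hr.2⟩
  calc _ = ∫⁻ y, ENNReal.ofReal ((1 + 2 * r * inner ℝ x y + r ^ 2) ^ (-q)) ∂μ := by
        refine lintegral_congr_ae ?_
        filter_upwards [hμ.ae_norm_eq_one] with y hy
        have e := norm_add_smul_sq hx hy r
        have hp : 0 < 1 + 2 * r * inner ℝ x y + r ^ 2 :=
          one_add_two_mul_add_sq_pos hr' (by
            have := abs_real_inner_le_norm x y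
            rwa [hx, hy, one_mul] at this)
        rw [nnnorm_rpow_neg_eq _ q, e]
        intro h0
        rw [h0, norm_zero] at e
        norm_num at e
        linarith
    _ = ∫⁻ u, ENNReal.ofReal ((1 + 2 * r * u + r ^ 2) ^ (-q))
          ∂(μ.map fun y => inner ℝ x y) := by
        rw [lintegral_map (by fun_prop) (by fun_prop)]
    _ = ENNReal.ofReal (radialMoment μ q r) := by
        rw [hμ.map_inner, hx, lintegral_map (by fun_prop) (by fun_prop), radialMoment,
          ofReal_integral_eq_lintegral_ofReal]
        · simp only [one_mul]
        · exact hμ.integrable_coord (g := fun u => (1 + 2 * r * u + r ^ 2) ^ (-q)) (by fun_prop)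
            (continuousOn_one_add_two_mul_rpow_right hr' _)
        · filter_upwards [hμ.ae_abs_le] with y hy
          exact Real.rpow_nonneg (one_add_two_mul_add_sq_pos hr' hy).le _
    _ ≤ _ := by
        refine ENNReal.ofReal_le_ofReal ((hμ.radialMoment_le (by linarith) hq1 hr).trans ?_)
        have h := quartic_le_Gamma_mul_Phi hq0 hq1 (sq_nonneg r)
          (show r ^ 2 ≤ 1 by nlinarith [hr.1, hr.2])
        refine le_trans (le_of_eq ?_) h
        ring

end IsUniformOnSphere

/-- The law of `∑ aᵢ ξᵢ`, where `a` runs through the list and the `ξᵢ` are independent with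
law `μ`. -/
noncomputable def sumLaw (μ : Measure (EuclideanSpace ℝ (Fin 4))) :
    List ℝ → Measure (EuclideanSpace ℝ (Fin 4))
  | [] => Measure.dirac 0
  | a :: l => Measure.conv (μ.map (a • ·)) (sumLaw μ l)

/-- The negative moment `E |w + ∑ aᵢ ξᵢ|^{-2 q}`. -/
noncomputable def negMoment (μ : Measure (EuclideanSpace ℝ (Fin 4))) (q : ℝ) (l : List ℝ)
    (w : EuclideanSpace ℝ (Fin 4)) : ℝ≥0∞ :=
  ∫⁻ v, (‖w + v‖₊ : ℝ≥0∞) ^ (-(2 * q)) ∂(sumLaw μ l)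

lemma negMoment_nil (μ : Measure (EuclideanSpace ℝ (Fin 4))) (q : ℝ)
    (w : EuclideanSpace ℝ (Fin 4)) :
    negMoment μ q [] w = (‖w‖₊ : ℝ≥0∞) ^ (-(2 * q)) := by
  rw [negMoment, sumLaw, lintegral_dirac' _ (by fun_prop), add_zero]

section sumLaw

variable {μ : Measure (EuclideanSpace ℝ (Fin 4))} [IsProbabilityMeasure μ]

instance isProbabilityMeasure_sumLaw (l : List ℝ) : IsProbabilityMeasure (sumLaw μ l) := by
  induction l with
  | nil => exact Measure.dirac.isProbabilityMeasure
  | cons a l ih =>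
    have : IsProbabilityMeasure (μ.map (a • ·)) :=
      Measure.isProbabilityMeasure_map (by fun_prop)
    exact Measure.probabilitymeasure_of_probabilitymeasures_conv _ _

lemma sumLaw_perm {l l' : List ℝ} (h : l.Perm l') : sumLaw μ l = sumLaw μ l' := by
  induction h with
  | nil => rfl
  | cons a _ ih => rw [sumLaw, sumLaw, ih]
  | swap a b l =>
    rw [sumLaw, sumLaw, sumLaw, sumLaw, ← Measure.conv_assoc, ← Measure.conv_assoc,
      Measure.conv_comm (μ.map (b • ·))]
  | trans _ _ h1 h2 => exact h1.trans h2

lemma lintegral_sumLaw_cons (a : ℝ) (l : List ℝ) {f : EuclideanSpace ℝ (Fin 4) → ℝ≥0∞}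
    (hf : Measurable f) :
    ∫⁻ v, f v ∂(sumLaw μ (a :: l)) = ∫⁻ x, (∫⁻ v, f (a • x + v) ∂(sumLaw μ l)) ∂μ := by
  rw [sumLaw, Measure.lintegral_conv hf, lintegral_map _ (by fun_prop)]
  exact Measurable.lintegral_prod_right' (f := fun z : _ × _ => f (z.1 + z.2)) (by fun_prop)

lemma map_smul_sumLaw (c : ℝ) (l : List ℝ) :
    (sumLaw μ l).map (c • ·) = sumLaw μ (l.map (c * ·)) := by
  induction l with
  | nil => simp [sumLaw, Measure.map_dirac' (measurable_const_smul c)]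
  | cons a l ih =>
    have h := Measure.map_conv_continuousLinearMap (μ := μ.map (a • ·)) (ν := sumLaw μ l)
      (c • ContinuousLinearMap.id ℝ (EuclideanSpace ℝ (Fin 4)))
    have e : ⇑(c • ContinuousLinearMap.id ℝ (EuclideanSpace ℝ (Fin 4))) = (c • ·) := by
      funext x; simp
    rw [e] at h
    rw [sumLaw, h, ih, List.map_cons, sumLaw, Measure.map_map (by fun_prop) (by fun_prop)]
    congr 2
    funext x
    simp [mul_smul]

lemma negMoment_perm (q : ℝ) {l l' : List ℝ} (h : l.Perm l') :
    negMoment μ q l = negMoment μ q l' := by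
  funext w
  rw [negMoment, negMoment, sumLaw_perm h]

lemma negMoment_cons (q a : ℝ) (l : List ℝ) (w : EuclideanSpace ℝ (Fin 4)) :
    negMoment μ q (a :: l) w = ∫⁻ x, negMoment μ q l (w + a • x) ∂μ := by
  rw [negMoment, lintegral_sumLaw_cons _ _ (by fun_prop)]
  simp only [negMoment, add_assoc]

lemma negMoment_map_mul (q : ℝ) {c : ℝ} (hc : 0 < c) (l : List ℝ) :
    negMoment μ q (l.map (c * ·)) 0 = ENNReal.ofReal (c ^ (-(2 * q))) * negMoment μ q l 0 := by
  rw [negMoment, negMoment, ← map_smul_sumLaw, lintegral_map (by fun_prop) (by fun_prop),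
    ← lintegral_const_mul _ (by fun_prop)]
  refine lintegral_congr fun v => ?_
  rw [zero_add, zero_add, nnnorm_smul, ENNReal.coe_mul,
    ENNReal.mul_rpow_of_ne_top ENNReal.coe_ne_top ENNReal.coe_ne_top,
    ← ENNReal.ofReal_rpow_of_pos hc, ← enorm_eq_nnnorm, Real.enorm_of_nonneg hc.le]

end sumLaw

namespace IsUniformOnSphere

variable {μ : Measure (EuclideanSpace ℝ (Fin 4))} [IsProbabilityMeasure μ]

lemma map_sumLaw (hμ : IsUniformOnSphere μ)
    (Q : EuclideanSpace ℝ (Fin 4) ≃ₗᵢ[ℝ] EuclideanSpace ℝ (Fin 4)) (l : List ℝ) :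
    (sumLaw μ l).map Q = sumLaw μ l := by
  induction l with
  | nil => simp [sumLaw, Measure.map_dirac' Q.continuous.measurable]
  | cons a l ih =>
    have h := Measure.map_conv_continuousLinearMap (μ := μ.map (a • ·)) (ν := sumLaw μ l)
      (Q.toContinuousLinearEquiv : EuclideanSpace ℝ (Fin 4) →L[ℝ] EuclideanSpace ℝ (Fin 4))
    have e : ⇑(Q.toContinuousLinearEquiv :
        EuclideanSpace ℝ (Fin 4) →L[ℝ] EuclideanSpace ℝ (Fin 4)) = Q := rfl
    rw [e, ih] at h
    rw [sumLaw, h, Measure.map_map Q.continuous.measurable (by fun_prop)]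
    have e2 : (⇑Q ∘ (a • ·)) = (a • ·) ∘ Q := by
      funext x
      simp
    rw [e2, ← Measure.map_map (by fun_prop) Q.continuous.measurable, hμ.2 Q]

lemma negMoment_isometry (hμ : IsUniformOnSphere μ)
    (Q : EuclideanSpace ℝ (Fin 4) ≃ₗᵢ[ℝ] EuclideanSpace ℝ (Fin 4)) (q : ℝ) (l : List ℝ)
    (w : EuclideanSpace ℝ (Fin 4)) : negMoment μ q l (Q w) = negMoment μ q l w := by
  rw [negMoment, ← hμ.map_sumLaw Q, lintegral_map (by fun_prop) Q.continuous.measurable]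
  refine lintegral_congr fun v => ?_
  rw [← map_add, Q.nnnorm_map]

lemma negMoment_eq_of_norm_eq (hμ : IsUniformOnSphere μ) (q : ℝ) (l : List ℝ)
    {v w : EuclideanSpace ℝ (Fin 4)} (h : ‖v‖ = ‖w‖) : negMoment μ q l v = negMoment μ q l w := by
  obtain ⟨Q, hQ⟩ := exists_isometry_map_eq v
  obtain ⟨R, hR⟩ := exists_isometry_map_eq w
  rw [← hμ.negMoment_isometry Q q l v, ← hμ.negMoment_isometry R q l w, hQ, hR, h]

/-- A rotation invariant sum only sees the norm of a shift. -/
lemma negMoment_norm_cons (hμ : IsUniformOnSphere μ) (q : ℝ) (l : List ℝ)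
    (w : EuclideanSpace ℝ (Fin 4)) : negMoment μ q (‖w‖ :: l) 0 = negMoment μ q l w := by
  rw [negMoment_cons]
  calc _ = ∫⁻ _, negMoment μ q l w ∂μ := by
        refine lintegral_congr_ae ?_
        filter_upwards [hμ.ae_norm_eq_one] with x hx
        exact hμ.negMoment_eq_of_norm_eq q l (by simp [norm_smul, hx])
    _ = _ := by simp

lemma charFun_eq (hμ : IsUniformOnSphere μ) (w : EuclideanSpace ℝ (Fin 4)) :
    charFun μ w = ((∫ x, cos (‖w‖ * x 0) ∂μ : ℝ) : ℂ) := by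
  have hi : ∀ f : EuclideanSpace ℝ (Fin 4) → ℝ, Measurable f → (∀ x, |f x| ≤ 1) →
      Integrable f μ := fun f hf hb =>
    Integrable.of_bound hf.aestronglyMeasurable 1 (Filter.Eventually.of_forall hb)
  have hs : ∫ x, sin (inner ℝ x w) ∂μ = 0 := by
    have h := hμ.integral_comp (LinearIsometryEquiv.neg ℝ) fun x => sin (inner ℝ x w)
    simp only [LinearIsometryEquiv.coe_neg, inner_neg_left, sin_neg, integral_neg] at h
    linarith
  have hc : ∫ x, cos (inner ℝ x w) ∂μ = ∫ x, cos (‖w‖ * x 0) ∂μ := by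
    have h1 := integral_map (μ := μ) (φ := fun x => inner ℝ w x) (f := cos) (by fun_prop)
      (by fun_prop)
    have h2 := integral_map (μ := μ) (φ := fun x : EuclideanSpace ℝ (Fin 4) => ‖w‖ * x 0)
      (f := cos) (by fun_prop) (by fun_prop)
    rw [← h2, ← hμ.map_inner, h1]
    simp only [real_inner_comm]
  have e : ∀ x, Complex.exp (inner ℝ x w * Complex.I) =
      ((cos (inner ℝ x w) : ℝ) : ℂ) + ((sin (inner ℝ x w) : ℝ) : ℂ) * Complex.I := fun x => by
    rw [Complex.exp_mul_I, Complex.ofReal_cos, Complex.ofReal_sin]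
  rw [charFun_apply]
  simp only [e]
  rw [integral_add (hi _ (by fun_prop) fun x => abs_cos_le_one _).ofReal
    ((hi _ (by fun_prop) fun x => abs_sin_le_one _).ofReal.mul_const _), integral_mul_const,
    integral_complex_ofReal, integral_complex_ofReal, hs, hc]
  simp

lemma charFun_sumLaw (hμ : IsUniformOnSphere μ) (l : List ℝ) (hl : ∀ a ∈ l, 0 ≤ a)
    (w : EuclideanSpace ℝ (Fin 4)) :
    charFun (sumLaw μ l) w =
      (((l.map fun a => ∫ x, cos (a * ‖w‖ * x 0) ∂μ).prod : ℝ) : ℂ) := by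
  induction l with
  | nil => simp [sumLaw]
  | cons a l ih =>
    have : IsProbabilityMeasure (μ.map (a • ·)) :=
      Measure.isProbabilityMeasure_map (by fun_prop)
    rw [sumLaw, charFun_conv, charFun_map_smul, hμ.charFun_eq,
      ih fun b hb => hl b (List.mem_cons_of_mem _ hb), norm_smul, Real.norm_eq_abs,
      abs_of_nonneg (hl a List.mem_cons_self), List.map_cons, List.prod_cons, Complex.ofReal_mul]

/-- The case where no coefficient carries more than half of the total variance. -/
lemma negMoment_le_of_two_mul_sq_le (hμ : IsUniformOnSphere μ) {l : List ℝ}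
    (hl : ∀ a ∈ l, 0 ≤ a) {S : ℝ} (hS : 0 < S) (hsum : (l.map (· ^ 2)).sum = S)
    (hhalf : ∀ a ∈ l, 2 * a ^ 2 ≤ S) {q : ℝ} (hq0 : 0 < q) (hq : q ≤ 1) :
    negMoment μ q l 0 ≤ ENNReal.ofReal (2 ^ q * Real.Gamma (2 - q) * S ^ (-q)) := by
  have h := hμ.isBesselProfile.lintegral_nnnorm_rpow_le (ρ := sumLaw μ l)
    (a := fun i : Fin l.length => l[i]) (fun i => hl _ (List.getElem_mem _)) hS
    (by
      rw [← hsum, ← List.sum_ofFn]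
      congr 1
      exact List.ofFn_getElem_eq_map l (· ^ 2))
    (fun i => hhalf _ (List.getElem_mem _)) (fun w => by
      rw [hμ.charFun_sumLaw l hl, ← List.prod_ofFn]
      congr 2
      exact (List.ofFn_getElem_eq_map l fun a => ∫ x, cos (a * ‖w‖ * x 0) ∂μ).symm) hq0 hq
  simpa only [negMoment, zero_add] using h

end IsUniformOnSphere

lemma List.sum_map_mul_sq (c : ℝ) (l : List ℝ) :
    ((l.map (c * ·)).map (· ^ 2)).sum = c ^ 2 * (l.map (· ^ 2)).sum := by
  induction l with
  | nil => simp
  | cons a l ih =>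
    simp only [List.map_cons, List.sum_cons] at ih ⊢
    rw [ih]
    ring

lemma List.sum_map_sq_nonneg (l : List ℝ) : 0 ≤ (l.map (· ^ 2)).sum :=
  List.sum_nonneg fun x hx => by
    obtain ⟨a, -, rfl⟩ := List.mem_map.1 hx
    positivity

namespace IsUniformOnSphere

variable {μ : Measure (EuclideanSpace ℝ (Fin 4))} [IsProbabilityMeasure μ]

/-- Rescaling reduces total variance at least `1` to total variance less than `1`. -/
lemma negMoment_one_cons_le_of_one_le (hμ : IsUniformOnSphere μ) {q : ℝ} (hq0 : 0 < q)
    (hq1 : q ≤ 1) {l : List ℝ} (hl : ∀ a ∈ l, 0 ≤ a) (hx : 1 ≤ (l.map (· ^ 2)).sum)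
    (H : ∀ l' : List ℝ, l'.length = l.length → (∀ a ∈ l', 0 ≤ a) → (l'.map (· ^ 2)).sum < 1 →
      negMoment μ q (1 :: l') 0 ≤
        ENNReal.ofReal (2 ^ q * Real.Gamma (2 - q) * Phi (2 * q) (l'.map (· ^ 2)).sum)) :
    negMoment μ q (1 :: l) 0 ≤
      ENNReal.ofReal (2 ^ q * Real.Gamma (2 - q) * Phi (2 * q) (l.map (· ^ 2)).sum) := by
  have hC : 0 ≤ 2 ^ q * Real.Gamma (2 - q) :=
    mul_nonneg (by positivity) (Real.Gamma_pos_of_pos (by linarith)).le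
  rw [Phi_of_one_le hx]
  by_cases hbig : ∃ a ∈ l, 1 + (l.map (· ^ 2)).sum < 2 * a ^ 2
  · obtain ⟨a, hal, ha⟩ := hbig
    have ha0 : 0 < a := (hl a hal).lt_of_ne (by rintro rfl; norm_num at ha; linarith)
    have hp := List.perm_cons_erase hal
    set m := l.erase a with hm
    have hsum : (l.map (· ^ 2)).sum = a ^ 2 + (m.map (· ^ 2)).sum := by
      rw [(hp.map _).sum_eq, List.map_cons, List.sum_cons]
    have hlen : l.length = m.length + 1 := by rw [hp.length_eq, List.length_cons]
    have e : (1 :: (1 :: m).map (a⁻¹ * ·)).map (a * ·) = a :: 1 :: m := by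
      simp [Function.comp_def, ha0.ne']
    have hperm : (1 :: l).Perm ((1 :: (1 :: m).map (a⁻¹ * ·)).map (a * ·)) := by
      rw [e]
      exact (hp.cons 1).trans (List.Perm.swap _ _ _)
    have hs' : (((1 :: m).map (a⁻¹ * ·)).map (· ^ 2)).sum =
        (a ^ 2)⁻¹ * (1 + (m.map (· ^ 2)).sum) := by
      rw [List.sum_map_mul_sq, List.map_cons, List.sum_cons, inv_pow, one_pow]
    have hm0 := List.sum_map_sq_nonneg m
    have h := H ((1 :: m).map (a⁻¹ * ·)) (by simp [hlen])
      (fun b hb => by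
        obtain ⟨c, hc, rfl⟩ := List.mem_map.1 hb
        refine mul_nonneg (inv_nonneg.2 ha0.le) ?_
        rcases List.mem_cons.1 hc with rfl | hc
        · exact zero_le_one
        · exact hl c (List.mem_of_mem_erase hc))
      (by
        rw [hs', inv_mul_lt_iff₀ (by positivity)]
        linarith)
    rw [negMoment_perm q hperm, negMoment_map_mul q ha0]
    refine (mul_le_mul_right h _).trans ?_
    rw [← ENNReal.ofReal_mul (by positivity)]
    refine ENNReal.ofReal_le_ofReal ?_
    have hP := Phi_le hq0.le (x := (a ^ 2)⁻¹ * (1 + (m.map (· ^ 2)).sum)) (by positivity)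
    have hS : 1 + (l.map (· ^ 2)).sum = a ^ 2 * (1 + (a ^ 2)⁻¹ * (1 + (m.map (· ^ 2)).sum)) := by
      rw [hsum]
      field_simp
      ring
    rw [hs', hS, Real.mul_rpow (by positivity) (by positivity), ← Real.rpow_natCast a 2,
      ← Real.rpow_mul ha0.le, Real.rpow_natCast,
      show ((2 : ℕ) : ℝ) * -q = -(2 * q) by push_cast; ring]
    calc _ ≤ a ^ (-(2 * q)) * (2 ^ q * Real.Gamma (2 - q) *
          (1 + (a ^ 2)⁻¹ * (1 + (m.map (· ^ 2)).sum)) ^ (-q)) := by gcongr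
      _ = _ := by ring
  · push Not at hbig
    refine hμ.negMoment_le_of_two_mul_sq_le (l := 1 :: l) (fun a ha => ?_) (by linarith)
      (by simp) (fun a ha => ?_) hq0 hq1
    · rcases List.mem_cons.1 ha with rfl | ha
      · exact zero_le_one
      · exact hl a ha
    · rcases List.mem_cons.1 ha with rfl | ha
      · linarith
      · exact hbig a ha

/-- Averaging `Phi` over a symmetric perturbation does not increase it. -/
lemma lintegral_Phi_add_inner_le (hμ : IsUniformOnSphere μ) {q : ℝ} (hq0 : 0 ≤ q) {C : ℝ}
    (hC : 0 ≤ C) {x c : ℝ} (hx : x < 1) (hc0 : 0 ≤ c) (hc : c ≤ x) {u : EuclideanSpace ℝ (Fin 4)}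
    (hu : ‖u‖ = 1) :
    ∫⁻ y, ENNReal.ofReal (C * Phi (2 * q) (x + c * inner ℝ u y)) ∂μ ≤
      ENNReal.ofReal (C * Phi (2 * q) x) := by
  have hmeas : Measurable fun y =>
      ENNReal.ofReal (C * Phi (2 * q) (x + c * inner ℝ u y)) :=
    (((measurable_Phi _).comp (by fun_prop)).const_mul C).ennreal_ofReal
  have hneg : ∫⁻ y, ENNReal.ofReal (C * Phi (2 * q) (x - c * inner ℝ u y)) ∂μ =
      ∫⁻ y, ENNReal.ofReal (C * Phi (2 * q) (x + c * inner ℝ u y)) ∂μ := by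
    conv_rhs => rw [← hμ.2 (LinearIsometryEquiv.neg ℝ)]
    rw [lintegral_map hmeas (LinearIsometryEquiv.continuous _).measurable]
    simp only [LinearIsometryEquiv.coe_neg, inner_neg_right, mul_neg, sub_eq_add_neg]
  have h2 : 2 * ∫⁻ y, ENNReal.ofReal (C * Phi (2 * q) (x + c * inner ℝ u y)) ∂μ ≤
      2 * ENNReal.ofReal (C * Phi (2 * q) x) := by
    calc _ = ∫⁻ y, (ENNReal.ofReal (C * Phi (2 * q) (x + c * inner ℝ u y)) +
          ENNReal.ofReal (C * Phi (2 * q) (x - c * inner ℝ u y))) ∂μ := by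
          rw [lintegral_add_left hmeas, hneg, two_mul]
      _ ≤ ∫⁻ _, 2 * ENNReal.ofReal (C * Phi (2 * q) x) ∂μ := by
          refine lintegral_mono_ae ?_
          filter_upwards [hμ.ae_norm_eq_one] with y hy
          have hin : |c * inner ℝ u y| ≤ x := by
            have := abs_real_inner_le_norm u y
            rw [hu, hy, one_mul] at this
            rw [abs_mul, abs_of_nonneg hc0]
            exact (mul_le_of_le_one_right hc0 this).trans hc
          have hP : Phi (2 * q) (x + c * inner ℝ u y) + Phi (2 * q) (x - c * inner ℝ u y) ≤
              2 * Phi (2 * q) x := by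
            have h := Phi_add_Phi_le hq0 hx (abs_nonneg _) hin
            rcases abs_cases (c * inner ℝ u y) with ⟨e, -⟩ | ⟨e, -⟩
            · rwa [e] at h
            · rw [e, sub_neg_eq_add, ← sub_eq_add_neg] at h
              linarith
          rw [← ENNReal.ofReal_add (mul_nonneg hC (Phi_nonneg hq0))
            (mul_nonneg hC (Phi_nonneg hq0)), two_mul (ENNReal.ofReal _),
            ← ENNReal.ofReal_add (mul_nonneg hC (Phi_nonneg hq0))
            (mul_nonneg hC (Phi_nonneg hq0))]
          refine ENNReal.ofReal_le_ofReal ?_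
          have := mul_le_mul_of_nonneg_left hP hC
          linarith
      _ = _ := by simp
  exact (ENNReal.mul_le_mul_iff_right two_ne_zero ENNReal.ofNat_ne_top).1 h2

/-- Merging two summands of a sum of total variance less than `1`. -/
lemma negMoment_one_cons_cons_cons_le (hμ : IsUniformOnSphere μ) {q : ℝ} (hq0 : 0 ≤ q) {C : ℝ}
    (hC : 0 ≤ C) {a b : ℝ} {l : List ℝ} (ha : 0 ≤ a) (hb : 0 ≤ b)
    (hx : ((a :: b :: l).map (· ^ 2)).sum < 1)
    (H : ∀ R : ℝ, 0 ≤ R → negMoment μ q (1 :: R :: l) 0 ≤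
      ENNReal.ofReal (C * Phi (2 * q) ((R :: l).map (· ^ 2)).sum)) :
    negMoment μ q (1 :: a :: b :: l) 0 ≤
      ENNReal.ofReal (C * Phi (2 * q) ((a :: b :: l).map (· ^ 2)).sum) := by
  have hp : (1 :: a :: b :: l).Perm (a :: b :: 1 :: l) :=
    (List.Perm.swap _ _ _).trans ((List.Perm.swap _ _ _).cons _)
  set x := ((a :: b :: l).map (· ^ 2)).sum with hxdef
  have hxe : x = a ^ 2 + (b ^ 2 + (l.map (· ^ 2)).sum) := by simp [hxdef]
  have hl := List.sum_map_sq_nonneg l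
  rw [negMoment_perm q hp, negMoment_cons]
  calc _ ≤ ∫⁻ _, ENNReal.ofReal (C * Phi (2 * q) x) ∂μ := by
        refine lintegral_mono_ae ?_
        filter_upwards [hμ.ae_norm_eq_one] with u hu
        rw [negMoment_cons]
        refine le_trans (lintegral_mono_ae ?_) (hμ.lintegral_Phi_add_inner_le hq0 hC hx
          (c := 2 * a * b) (by positivity) (by nlinarith [sq_nonneg (a - b)]) hu)
        filter_upwards [hμ.ae_norm_eq_one] with y hy
        rw [← hμ.negMoment_norm_cons, negMoment_perm q (List.Perm.swap _ _ _)]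
        refine (H _ (norm_nonneg _)).trans (le_of_eq ?_)
        rw [List.map_cons, List.sum_cons, zero_add, norm_add_sq_real, norm_smul, norm_smul, hu, hy,
          inner_smul_left, inner_smul_right, hxe]
        simp only [mul_one, Real.norm_eq_abs, sq_abs, conj_trivial]
        congr 3
        ring
    _ = _ := by simp

lemma negMoment_one_singleton_le (hμ : IsUniformOnSphere μ) {q : ℝ} (hq0 : 1 / 8 ≤ q)
    (hq1 : q ≤ 1) {r : ℝ} (hr : r ∈ Ico (0 : ℝ) 1) :
    negMoment μ q [1, r] 0 ≤
      ENNReal.ofReal (2 ^ q * Real.Gamma (2 - q) * Phi (2 * q) (r ^ 2)) := by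
  rw [negMoment_cons]
  calc _ ≤ ∫⁻ _, ENNReal.ofReal (2 ^ q * Real.Gamma (2 - q) * Phi (2 * q) (r ^ 2)) ∂μ := by
        refine lintegral_mono_ae ?_
        filter_upwards [hμ.ae_norm_eq_one] with x hx
        rw [negMoment_cons]
        simp only [negMoment_nil, zero_add, one_smul]
        exact hμ.lintegral_nnnorm_add_smul_rpow_le hq0 hq1 hr hx
    _ = _ := by simp

lemma negMoment_one_cons_le (hμ : IsUniformOnSphere μ) {q : ℝ} (hq0 : 1 / 8 ≤ q) (hq1 : q ≤ 1)
    (n : ℕ) (l : List ℝ) (hn : l.length = n + 1) (hl : ∀ a ∈ l, 0 ≤ a) :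
    negMoment μ q (1 :: l) 0 ≤
      ENNReal.ofReal (2 ^ q * Real.Gamma (2 - q) * Phi (2 * q) (l.map (· ^ 2)).sum) := by
  have hq : 0 < q := by linarith
  have hC : 0 ≤ 2 ^ q * Real.Gamma (2 - q) :=
    mul_nonneg (by positivity) (Real.Gamma_pos_of_pos (by linarith)).le
  induction n generalizing l with
  | zero =>
    have H : ∀ l' : List ℝ, l'.length = 1 → (∀ a ∈ l', 0 ≤ a) → (l'.map (· ^ 2)).sum < 1 →
        negMoment μ q (1 :: l') 0 ≤
          ENNReal.ofReal (2 ^ q * Real.Gamma (2 - q) * Phi (2 * q) (l'.map (· ^ 2)).sum) := by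
      intro l' h1 h2 h3
      obtain ⟨r, rfl⟩ := List.length_eq_one_iff.1 h1
      have hr := h2 r (by simp)
      simp only [List.map_cons, List.map_nil, List.sum_cons, List.sum_nil, add_zero] at h3 ⊢
      exact hμ.negMoment_one_singleton_le hq0 hq1 ⟨hr, (sq_lt_one_iff₀ hr).1 h3⟩
    rcases lt_or_ge (l.map (· ^ 2)).sum 1 with hx | hx
    · exact H l hn hl hx
    · exact hμ.negMoment_one_cons_le_of_one_le hq hq1 hl hx fun l' h => H l' (h.trans hn)
  | succ n ih =>
    have H : ∀ l' : List ℝ, l'.length = n + 2 → (∀ a ∈ l', 0 ≤ a) → (l'.map (· ^ 2)).sum < 1 →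
        negMoment μ q (1 :: l') 0 ≤
          ENNReal.ofReal (2 ^ q * Real.Gamma (2 - q) * Phi (2 * q) (l'.map (· ^ 2)).sum) := by
      intro l' h1 h2 h3
      match l', h1, h2, h3 with
      | a :: b :: m, h1, h2, h3 =>
        refine hμ.negMoment_one_cons_cons_cons_le hq.le hC (h2 a (by simp)) (h2 b (by simp)) h3
          fun R hR => ih _ (by simpa using h1) fun c hc => ?_
        rcases List.mem_cons.1 hc with rfl | hc
        · exact hR
        · exact h2 c (by simp [hc])
    rcases lt_or_ge (l.map (· ^ 2)).sum 1 with hx | hx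
    · exact H l hn hl hx
    · exact hμ.negMoment_one_cons_le_of_one_le hq hq1 hl hx fun l' h => H l' (h.trans hn)

end IsUniformOnSphere

/-- The law of `∑ aₖ ξₖ` is the iterated convolution. -/
lemma map_sum_smul_pi (μ : Measure (EuclideanSpace ℝ (Fin 4))) [IsProbabilityMeasure μ] {n : ℕ}
    (a : Fin n → ℝ) :
    (Measure.pi fun _ : Fin n => μ).map (fun x => ∑ k, a k • x k) = sumLaw μ (List.ofFn a) := by
  induction n with
  | zero => simp [sumLaw]
  | succ n ih =>
    refine Measure.ext_of_lintegral _ fun f hf => ?_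
    rw [List.ofFn_succ, lintegral_sumLaw_cons _ _ hf, ← ih, lintegral_map hf (by fun_prop),
      ← (measurePreserving_piFinSuccAbove (fun _ => μ) 0).symm.lintegral_comp (by fun_prop),
      lintegral_prod _ (by fun_prop)]
    refine lintegral_congr fun x => ?_
    rw [lintegral_map (by fun_prop) (by fun_prop)]
    refine lintegral_congr fun y => ?_
    simp [Fin.sum_univ_succ, MeasurableEquiv.piFinSuccAbove]

/-- Strengthened inductive inequality: for `1/4 ≤ p ≤ 2`, `n ≥ 2`, `a₁ = 1`,
`a₂, …, aₙ ≥ 0`, for independent `ξ₁, …, ξₙ` uniform on `S³ ⊂ ℝ⁴`,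
`E|∑ aₖ ξₖ|^{-p} ≤ 2^{p/2} Γ(2-p/2) Φ_p(∑_{k≥2} aₖ²)`. -/
theorem strengthened_inductive_inequality
    (p : ℝ) (hp1 : 1 / 4 ≤ p) (hp2 : p ≤ 2)
    (μ : Measure (EuclideanSpace ℝ (Fin 4))) [IsProbabilityMeasure μ]
    (hμ : IsUniformOnSphere μ)
    (n : ℕ) (hn : 2 ≤ n) (a : Fin n → ℝ)
    (ha0 : a ⟨0, by omega⟩ = 1) (hak : ∀ k, 0 ≤ a k) :
    ∫⁻ x, (‖∑ k, a k • x k‖₊ : ℝ≥0∞) ^ (-p) ∂(Measure.pi fun _ : Fin n => μ)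
      ≤ ENNReal.ofReal ((2 : ℝ) ^ (p / 2) * Real.Gamma (2 - p / 2) *
          Phi p (∑ k ∈ Finset.univ.erase (⟨0, by omega⟩ : Fin n), (a k) ^ 2)) := by
  obtain ⟨m, rfl⟩ := Nat.exists_eq_add_of_le' hn
  have e0 : (⟨0, by omega⟩ : Fin (m + 2)) = 0 := rfl
  rw [e0] at ha0 ⊢
  have hsum : ∑ k ∈ Finset.univ.erase (0 : Fin (m + 2)), (a k) ^ 2 =
      ((List.ofFn fun k : Fin (m + 1) => a k.succ).map (· ^ 2)).sum := by
    rw [List.map_ofFn, List.sum_ofFn]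
    have h1 := Finset.add_sum_erase Finset.univ (fun k => a k ^ 2) (Finset.mem_univ 0)
    rw [Fin.sum_univ_succ] at h1
    exact add_left_cancel h1
  have h := hμ.negMoment_one_cons_le (q := p / 2) (by linarith) (by linarith) m
    (List.ofFn fun k => a k.succ) (by simp) (fun b hb => by
      obtain ⟨k, rfl⟩ := List.mem_ofFn.1 hb
      exact hak _)
  rw [← hsum, mul_div_cancel₀ p two_ne_zero] at h
  refine le_trans (le_of_eq ?_) h
  rw [negMoment, mul_div_cancel₀ p two_ne_zero, ← ha0, ← List.ofFn_succ, ← map_sum_smul_pi,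
    lintegral_map (by fun_prop) (by fun_prop)]
  simp only [zero_add]
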